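/- Assume ν > −1/2 and let A₀ > 0. Let (η_j)_{j≥0} be any family of continuously differentiable functions on (0,1) such that supp η_j ⊆ I_j*, 0 ≤ η_j ≤ 1, |η_j′(x)| ≤ A₀ 2^j for all x, and Σ_{j=0}^∞ η_j(x) = 1 for all x ∈ (0,1). Then there exists a constant C = C(ν, A₀) such that for every y ∈ (0,1), ∫_0^1 Σ_{j=0}^∞ sup_{0<t<μ(I_j**)} |(η_j(x) − η_j(y)) 𝒫_t(x,y)| dμ(x) ≤ C. -/

import Mathlib

open MeasureTheory Real Set Filter Topology
open scoped ENNReal NNReal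

/-- Bessel function of the first kind of order `ν` (defined by its power series). -/
noncomputable def besselJ (ν x : ℝ) : ℝ :=
  ∑' m : ℕ, ((-1 : ℝ) ^ m / ((m.factorial : ℝ) * Real.Gamma ((m : ℝ) + ν + 1))) *
    (x / 2) ^ (2 * (m : ℝ) + ν)

/-- `Λ` enumerates the successive positive zeros of `J_ν`, in increasing order,
`Λ n` corresponding to `λ_{n+1,ν}`. -/
def IsPositiveZerosOfBesselJ (ν : ℝ) (Λ : ℕ → ℝ) : Prop :=
  StrictMono Λ ∧ (∀ n, 0 < Λ n) ∧ (∀ n, besselJ ν (Λ n) = 0) ∧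
    ∀ x : ℝ, 0 < x → besselJ ν x = 0 → ∃ n, Λ n = x

/-- The eigenfunctions `φ_n^ν`. -/
noncomputable def phiFB (ν : ℝ) (Λ : ℕ → ℝ) (n : ℕ) (x : ℝ) : ℝ :=
  (Real.sqrt 2 / |Λ n * besselJ (ν + 1) (Λ n)|) * Real.sqrt (Λ n) *
    besselJ ν (Λ n * x) * x ^ (-ν)

/-- The Fourier–Bessel Poisson kernel `𝒫_t(x,y)`. -/
noncomputable def pKer (ν : ℝ) (Λ : ℕ → ℝ) (t x y : ℝ) : ℝ :=
  ∑' n : ℕ, Real.exp (-t * Λ n) * phiFB ν Λ n x * phiFB ν Λ n y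

/-- The kernel `P_t(x,y) = (xy)^{ν+1/2} 𝒫_t(x,y)`. -/
noncomputable def pKerL (ν : ℝ) (Λ : ℕ → ℝ) (t x y : ℝ) : ℝ :=
  (x * y) ^ (ν + 1/2) * pKer ν Λ t x y

/-- The measure `dμ(x) = x^{2ν+1} dx` on `(0,1)`. -/
noncomputable def muMeas (ν : ℝ) : Measure ℝ :=
  (volume.restrict (Ioo 0 1)).withDensity fun x => ENNReal.ofReal (x ^ (2 * ν + 1))

noncomputable def pI (j : ℕ) : ℝ := 1 - (1/2 : ℝ) ^ j
noncomputable def qI (j : ℕ) : ℝ := 1 - (1/2 : ℝ) ^ (j + 1)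

/-- The `s`-dilate (same center, `s` times the length) of `(p,q]`, intersected with `(0,1)`. -/
def starSet (s p q : ℝ) : Set ℝ :=
  Ioc ((p + q)/2 - s * (q - p)/2) ((p + q)/2 + s * (q - p)/2) ∩ Ioo 0 1

noncomputable def Istar (j : ℕ) : Set ℝ := starSet (51/50) (pI j) (qI j)
noncomputable def Istar2 (j : ℕ) : Set ℝ := starSet ((51/50)^2) (pI j) (qI j)

noncomputable def pJ (j : ℤ) : ℝ := if 1 ≤ j then 1 - (2:ℝ) ^ (-j) else (2:ℝ) ^ (j - 1)
noncomputable def qJ (j : ℤ) : ℝ := if 1 ≤ j then 1 - (2:ℝ) ^ (-j - 1) else (2:ℝ) ^ j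

noncomputable def Jstar (j : ℤ) : Set ℝ := starSet (51/50) (pJ j) (qJ j)
noncomputable def Jstar2 (j : ℤ) : Set ℝ := starSet ((51/50)^2) (pJ j) (qJ j)

/-- Modified Bessel function of the first kind. -/
noncomputable def besselI (ν x : ℝ) : ℝ :=
  ∑' m : ℕ, (1 / ((m.factorial : ℝ) * Real.Gamma ((m : ℝ) + ν + 1))) *
    (x / 2) ^ (2 * (m : ℝ) + ν)

/-- The Bessel heat kernel `𝐓_t(x,y)` on `(0,∞)`. -/
noncomputable def bHeatKer (ν t x y : ℝ) : ℝ :=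
  (2*t)⁻¹ * Real.exp (-(x^2 + y^2)/(4*t)) * besselI ν (x*y/(2*t)) * (x*y) ^ (-ν)

/-- The Fourier–Bessel heat kernel `𝒯_t(x,y)` on `(0,1)`. -/
noncomputable def fbHeatKer (ν : ℝ) (Λ : ℕ → ℝ) (t x y : ℝ) : ℝ :=
  ∑' n : ℕ, Real.exp (-t * (Λ n)^2) * phiFB ν Λ n x * phiFB ν Λ n y

/-- Taylor coefficients of the entire function `z ↦ Γ`-normalised Bessel function. -/
noncomputable def besC (ν : ℝ) (m : ℕ) : ℝ :=
  (4 ^ m * (m.factorial : ℝ) * Real.Gamma ((m : ℝ) + ν + 1))⁻¹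

lemma besC_pos {ν : ℝ} (hν : -1 < ν) (m : ℕ) : 0 < besC ν m := by
  have : 0 < Real.Gamma ((m : ℝ) + ν + 1) := Real.Gamma_pos_of_pos (by
    have : (0 : ℝ) ≤ m := Nat.cast_nonneg m
    linarith)
  unfold besC; positivity

lemma besC_eq_shift {ν : ℝ} (hν : -1 < ν) (m : ℕ) :
    besC ν m = (m + ν + 1) * besC (ν + 1) m := by
  have h0 : (0 : ℝ) ≤ m := Nat.cast_nonneg m
  have h1 : (m : ℝ) + ν + 1 ≠ 0 := by linarith
  have h2 : Real.Gamma ((m : ℝ) + ν + 1) ≠ 0 := (Real.Gamma_pos_of_pos (by linarith)).ne'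
  unfold besC
  rw [show (m : ℝ) + (ν + 1) + 1 = (m + ν + 1) + 1 by ring, Real.Gamma_add_one h1]
  have : (m.factorial : ℝ) ≠ 0 := by positivity
  field_simp

lemma succ_mul_besC (ν : ℝ) (m : ℕ) :
    ((m : ℝ) + 1) * besC ν (m + 1) = besC (ν + 1) m / 4 := by
  unfold besC
  rw [show ((m + 1 : ℕ) : ℝ) + ν + 1 = (m : ℝ) + (ν + 1) + 1 by push_cast; ring,
    Nat.factorial_succ]
  have : (m.factorial : ℝ) ≠ 0 := by positivity
  have : (m : ℝ) + 1 ≠ 0 := by positivity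
  push_cast
  rw [pow_succ]
  simp only [mul_inv]
  field_simp

lemma besC_succ_ratio {ν : ℝ} (hν : -1 < ν) (m : ℕ) :
    besC ν (m + 1) = besC ν m / (4 * (m + 1) * (m + ν + 1)) := by
  have h0 : (0 : ℝ) ≤ m := Nat.cast_nonneg m
  have h1 : (m : ℝ) + ν + 1 ≠ 0 := by linarith
  have h2 : (m : ℝ) + 1 ≠ 0 := by linarith
  have := succ_mul_besC ν m
  rw [besC_eq_shift hν m]
  field_simp
  linarith

lemma summable_besC {ν : ℝ} (hν : -1 < ν) (r : ℝ) : Summable fun m => besC ν m * r ^ m := by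
  rcases eq_or_ne r 0 with rfl | hr
  · exact summable_of_ne_finset_zero (s := {0}) fun m hm => by
      rw [zero_pow (by simpa using hm), mul_zero]
  refine summable_of_ratio_test_tendsto_lt_one (l := 0) one_pos
    (Eventually.of_forall fun n => mul_ne_zero (besC_pos hν n).ne' (pow_ne_zero _ hr)) ?_
  have h1 : ∀ m : ℕ, ‖besC ν (m + 1) * r ^ (m + 1)‖ / ‖besC ν m * r ^ m‖
      = |r| / (4 * (m + 1) * (m + ν + 1)) := by
    intro m
    have h0 : (0 : ℝ) ≤ m := Nat.cast_nonneg m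
    have h1 : 0 < (m : ℝ) + ν + 1 := by linarith
    have hp := besC_pos hν m
    rw [besC_succ_ratio hν m, norm_mul, norm_mul, norm_div, pow_succ, norm_mul]
    simp only [Real.norm_eq_abs]
    have h4 : |4 * ((m : ℝ) + 1) * (m + ν + 1)| = 4 * ((m : ℝ) + 1) * (m + ν + 1) :=
      abs_of_pos (by positivity)
    rw [abs_of_pos hp, ← abs_mul (4 * ((m : ℝ) + 1)), h4, abs_mul (r ^ m)]
    have : |r ^ m| ≠ 0 := by simpa using pow_ne_zero _ hr
    field_simp
  simp_rw [h1]
  refine Tendsto.div_atTop tendsto_const_nhds ?_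
  refine tendsto_atTop_mono (f := fun m : ℕ => 4 * ((m : ℝ) + ν + 1)) (fun m => ?_) ?_
  · have h0 : (0 : ℝ) ≤ m := Nat.cast_nonneg m
    have h1 : 0 < (m : ℝ) + ν + 1 := by linarith
    nlinarith
  · refine Tendsto.const_mul_atTop (by norm_num) ?_
    exact tendsto_atTop_add_const_right _ _ (tendsto_atTop_add_const_right _ _
      tendsto_natCast_atTop_atTop)

section RCLike
variable {𝕜 : Type*} [RCLike 𝕜]

/-- The entire function with `J_ν(x) = (x/2)^ν bes ν (-x²)`. -/
noncomputable def bes (ν : ℝ) (z : 𝕜) : 𝕜 := ∑' m, (besC ν m : 𝕜) * z ^ m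

lemma summable_bes {ν : ℝ} (hν : -1 < ν) (z : 𝕜) : Summable fun m => (besC ν m : 𝕜) * z ^ m := by
  refine Summable.of_norm ?_
  have := summable_besC hν ‖z‖
  refine this.congr fun m => ?_
  rw [norm_mul, norm_pow, RCLike.norm_ofReal, abs_of_pos (besC_pos hν m)]

lemma bes_hasDerivAt {ν : ℝ} (hν : -1 < ν) (z : 𝕜) :
    HasDerivAt (bes ν) (bes (ν + 1) z / 4) z := by
  have hs : Summable fun m : ℕ => (m : ℝ) * besC ν m * (‖z‖ + 1) ^ (m - 1) := by
    rw [← summable_nat_add_iff 1]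
    refine ((summable_besC (show -1 < ν + 1 by linarith) (‖z‖ + 1)).div_const 4).congr fun m => ?_
    push_cast
    rw [succ_mul_besC]
    ring
  have hd := hasDerivAt_tsum_of_isPreconnected (𝕜 := 𝕜)
    (g := fun (m : ℕ) (y : 𝕜) => (besC ν m : 𝕜) * y ^ m)
    (g' := fun (m : ℕ) (y : 𝕜) => (besC ν m : 𝕜) * (m * y ^ (m - 1)))
    (t := Metric.ball 0 (‖z‖ + 1)) (y₀ := 0) (y := z) hs Metric.isOpen_ball
    (Metric.isPreconnected_ball)
    (fun m y _ => (hasDerivAt_pow m y).const_mul _)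
    (fun m y hy => by
      rw [norm_mul, norm_mul, norm_pow, RCLike.norm_ofReal, abs_of_pos (besC_pos hν m),
        RCLike.norm_natCast]
      have : ‖y‖ ≤ ‖z‖ + 1 := by simpa using (mem_ball_zero_iff.1 hy).le
      have := besC_pos hν m
      calc besC ν m * (m * ‖y‖ ^ (m - 1)) = m * besC ν m * ‖y‖ ^ (m - 1) := by ring
        _ ≤ _ := by gcongr)
    (Metric.mem_ball_self (by positivity)) (summable_bes hν 0)
    (by simp)
  refine hd.congr_deriv ?_
  have hs2 : Summable fun (m : ℕ) => (besC ν m : 𝕜) * (m * z ^ (m - 1)) := by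
    rw [← summable_nat_add_iff 1]
    refine ((summable_bes (show -1 < ν + 1 by linarith) z).div_const 4).congr fun m => ?_
    have := congrArg (fun r : ℝ => (r : 𝕜)) (succ_mul_besC ν m)
    push_cast at this ⊢
    linear_combination (-z ^ m) * this
  rw [hs2.tsum_eq_zero_add]
  simp only [Nat.cast_zero, zero_mul, mul_zero, zero_add]
  unfold bes
  rw [← tsum_div_const]
  refine tsum_congr fun m => ?_
  have := congrArg (fun r : ℝ => (r : 𝕜)) (succ_mul_besC ν m)
  push_cast at this ⊢
  linear_combination (z ^ m) * this

lemma bes_recurrence {ν : ℝ} (hν : -1 < ν) (z : 𝕜) :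
    z * bes (ν + 2) z / 4 + ((ν + 1 : ℝ) : 𝕜) * bes (ν + 1) z = bes ν z := by
  have h1 := summable_bes (show -1 < ν + 1 by linarith) z
  have h2 := summable_bes (show -1 < ν + 2 by linarith) z
  have h0 := summable_bes hν z
  unfold bes
  rw [h0.tsum_eq_zero_add, h1.tsum_eq_zero_add, mul_add, ← tsum_mul_left, ← tsum_mul_left,
    ← tsum_div_const, add_left_comm, ← Summable.tsum_add]
  · congr 1
    · rw [besC_eq_shift hν 0]; push_cast; ring
    · refine tsum_congr fun m => ?_
      have e1 := congrArg (fun r : ℝ => (r : 𝕜)) (succ_mul_besC (ν + 1) m)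
      have e2 := congrArg (fun r : ℝ => (r : 𝕜)) (besC_eq_shift hν (m + 1))
      rw [show ν + 1 + 1 = ν + 2 by ring] at e1
      push_cast at e1 e2 ⊢
      linear_combination (-z ^ (m + 1)) * e1 - (z ^ (m + 1)) * e2
  · exact (h2.mul_left z).div_const 4
  · exact ((summable_nat_add_iff 1).2 h1).mul_left _

lemma continuous_bes {ν : ℝ} (hν : -1 < ν) : Continuous (bes ν : 𝕜 → 𝕜) :=
  continuous_iff_continuousAt.2 fun z => (bes_hasDerivAt hν z).continuousAt

lemma ofReal_bes (ν : ℝ) (x : ℝ) : ((bes ν x : ℝ) : 𝕜) = bes ν (x : 𝕜) := by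
  unfold bes
  rw [RCLike.ofReal_tsum]
  push_cast
  rfl

end RCLike

lemma bes_pos {ν : ℝ} (hν : -1 < ν) {x : ℝ} (hx : 0 ≤ x) : 0 < bes ν x := by
  refine (summable_bes hν x).tsum_pos (fun m => ?_) 0 ?_
  · have := besC_pos hν m
    simp only [RCLike.ofReal_real_eq_id, id]; positivity
  · simpa using besC_pos hν 0

lemma besselJ_eq {ν : ℝ} {x : ℝ} (hx : 0 < x) :
    besselJ ν x = (x / 2) ^ ν * bes ν (-x ^ 2) := by
  unfold besselJ bes
  rw [← tsum_mul_left]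
  refine tsum_congr fun m => ?_
  rw [Real.rpow_add (by positivity), Real.rpow_mul (by positivity), Real.rpow_natCast]
  simp only [RCLike.ofReal_real_eq_id, id, besC]
  rw [neg_pow (x ^ 2), ← pow_mul, Real.rpow_two, div_pow]
  norm_num
  rw [div_pow, ← pow_mul]
  field_simp

lemma hasFPowerSeriesOnBall_of_le_besC {ν : ℝ} (hν : -1 < ν) {b : ℕ → ℂ} {M : ℝ}
    (hb : ∀ m, ‖b m‖ ≤ M * besC ν m) :
    HasFPowerSeriesOnBall (fun z : ℂ => ∑' m, b m * z ^ m)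
      (FormalMultilinearSeries.ofScalars ℂ b) 0 ⊤ := by
  have hr : (FormalMultilinearSeries.ofScalars ℂ b).radius = ⊤ := by
    refine FormalMultilinearSeries.radius_eq_top_of_summable_norm _ fun r => ?_
    refine Summable.of_nonneg_of_le (fun _ => by positivity) (fun n => ?_)
      ((summable_besC hν r).mul_left M)
    rw [FormalMultilinearSeries.ofScalars_norm, ← mul_assoc]
    gcongr
    exact hb n
  have h := FormalMultilinearSeries.hasFPowerSeriesOnBall
    (FormalMultilinearSeries.ofScalars ℂ b) (by rw [hr]; simp)
  rw [hr] at h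
  convert h using 1
  ext z
  change _ = FormalMultilinearSeries.ofScalarsSum b z
  rw [FormalMultilinearSeries.ofScalars_sum_eq]
  simp [smul_eq_mul]

lemma eq_zero_of_tsum_eq_zero {ν : ℝ} (hν : -1 < ν) {b : ℕ → ℂ} {M : ℝ}
    (hb : ∀ m, ‖b m‖ ≤ M * besC ν m) (h : ∀ z : ℂ, ∑' m, b m * z ^ m = 0) (m : ℕ) : b m = 0 := by
  have h1 := (hasFPowerSeriesOnBall_of_le_besC hν hb).hasFPowerSeriesAt
  have h2 : (fun z : ℂ => ∑' m, b m * z ^ m) = 0 := funext h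
  rw [h2] at h1
  have := h1.eq_zero
  rw [FormalMultilinearSeries.ofScalars_series_eq_zero] at this
  exact congrFun this m

section RCLike
variable {𝕜 : Type*} [RCLike 𝕜]

/-- `f` solves `(x^{2ν+1} f′)′ = k x^{2ν+1} f` at `x`, with quasi-derivative `q = x^{2ν+1} f′`. -/
def IsBesselSol (ν : ℝ) (k : 𝕜) (f q : ℝ → 𝕜) (x : ℝ) : Prop :=
  HasDerivAt f ((x ^ (2 * ν + 1))⁻¹ • q x) x ∧
    HasDerivAt q ((x ^ (2 * ν + 1)) • (k * f x)) x

lemma continuous_weight {ν : ℝ} (hν : -(1 / 2 : ℝ) < ν) :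
    Continuous fun x : ℝ => x ^ (2 * ν + 1) :=
  Real.continuous_rpow_const (by linarith)

lemma lagrange_identity {ν : ℝ} (hν : -(1 / 2 : ℝ) < ν) {k l : 𝕜} {f g qf qg : ℝ → 𝕜}
    {a b : ℝ} (hab : a ≤ b) (hf : ContinuousOn f (Icc a b))
    (hg : ContinuousOn g (Icc a b)) (hqf : ContinuousOn qf (Icc a b))
    (hqg : ContinuousOn qg (Icc a b)) (hfs : ∀ x ∈ Ioo a b, IsBesselSol ν k f qf x)
    (hgs : ∀ x ∈ Ioo a b, IsBesselSol ν l g qg x) :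
    (k - l) * ∫ x in a..b, (x ^ (2 * ν + 1)) • (f x * g x) =
      (qf b * g b - f b * qg b) - (qf a * g a - f a * qg a) := by
  rw [← intervalIntegral.integral_const_mul]
  refine intervalIntegral.integral_eq_sub_of_hasDerivAt_of_le
    (f := fun x => qf x * g x - f x * qg x) hab ?_ ?_ ?_
  · exact (hqf.mul hg).sub (hf.mul hqg)
  · intro x hx
    obtain ⟨hf1, hf2⟩ := hfs x hx
    obtain ⟨hg1, hg2⟩ := hgs x hx
    refine ((hf2.mul hg1).sub (hf1.mul hg2)).congr_deriv ?_
    simp only [RCLike.real_smul_eq_coe_mul]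
    ring
  · refine ContinuousOn.intervalIntegrable_of_Icc hab ?_
    exact continuousOn_const.mul
      ((continuous_weight hν).continuousOn.smul (hf.mul hg))

/-- The solution of `(x^{2ν+1} f′)′ = k x^{2ν+1} f` regular at the origin. -/
noncomputable def regA (ν : ℝ) (k : 𝕜) (x : ℝ) : 𝕜 := bes ν (k * (x : 𝕜) ^ 2)

/-- The quasi-derivative of `regA`. -/
noncomputable def regQ (ν : ℝ) (k : 𝕜) (x : ℝ) : 𝕜 :=
  (x ^ (2 * ν + 2)) • (k / 2 * bes (ν + 1) (k * (x : 𝕜) ^ 2))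

lemma continuous_regA {ν : ℝ} (hν : -1 < ν) (k : 𝕜) : Continuous (regA ν k) :=
  (continuous_bes hν).comp (by fun_prop)

lemma continuous_regQ {ν : ℝ} (hν : -1 < ν) (k : 𝕜) : Continuous (regQ ν k) := by
  refine Continuous.smul (Real.continuous_rpow_const (by linarith)) (continuous_const.mul ?_)
  exact (continuous_bes (by linarith)).comp (by fun_prop)

lemma hasDerivAt_const_mul_ofReal_sq (k : 𝕜) (x : ℝ) :
    HasDerivAt (fun x : ℝ => k * (x : 𝕜) ^ 2) (k * (2 * x)) x := by
  have h : HasDerivAt (fun x : ℝ => (x : 𝕜)) 1 x := by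
    simpa using (RCLike.ofRealCLM (K := 𝕜)).hasDerivAt (x := x)
  simpa using (h.pow 2).const_mul k

lemma isBesselSol_reg {ν : ℝ} (hν : -1 < ν) (k : 𝕜) {x : ℝ} (hx : 0 < x) :
    IsBesselSol ν k (regA ν k) (regQ ν k) x := by
  have hs := hasDerivAt_const_mul_ofReal_sq k x
  have h0 := (bes_hasDerivAt hν (k * (x : 𝕜) ^ 2)).comp x hs
  have h1 := (bes_hasDerivAt (show -1 < ν + 1 by linarith) (k * (x : 𝕜) ^ 2)).comp x hs
  have e : x ^ (2 * ν + 2) = x ^ (2 * ν + 1) * x := by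
    rw [show 2 * ν + 2 = 2 * ν + 1 + 1 by ring, Real.rpow_add_one hx.ne']
  have hp : x ^ (2 * ν + 1) ≠ 0 := (Real.rpow_pos_of_pos hx _).ne'
  constructor
  · refine h0.congr_deriv ?_
    unfold regQ
    rw [smul_smul, e, inv_mul_cancel_left₀ hp]
    simp only [RCLike.real_smul_eq_coe_mul]
    ring
  · have hr := Real.hasDerivAt_rpow_const (x := x) (p := 2 * ν + 2) (Or.inl hx.ne')
    refine (hr.smul (h1.const_mul (k / 2))).congr_deriv ?_
    unfold regA
    rw [← bes_recurrence hν, show 2 * ν + 2 - 1 = 2 * ν + 1 by ring, e,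
      show ν + 1 + 1 = ν + 2 by ring]
    simp only [RCLike.real_smul_eq_coe_mul, Function.comp]
    push_cast
    ring

lemma regQ_zero {ν : ℝ} (hν : -1 < ν) (k : 𝕜) : regQ ν k 0 = 0 := by
  unfold regQ
  rw [Real.zero_rpow (by linarith), zero_smul]

lemma regA_one (ν : ℝ) (k : 𝕜) : regA ν k 1 = bes ν k := by simp [regA]

lemma regQ_one (ν : ℝ) (k : 𝕜) : regQ ν k 1 = k / 2 * bes (ν + 1) k := by simp [regQ]

lemma lagrange_reg {ν : ℝ} (hν : -(1 / 2 : ℝ) < ν) (k l : 𝕜) :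
    (k - l) * ∫ x in (0 : ℝ)..1, (x ^ (2 * ν + 1)) • (regA ν k x * regA ν l x) =
      regQ ν k 1 * regA ν l 1 - regA ν k 1 * regQ ν l 1 := by
  have h1 : -1 < ν := by linarith
  rw [lagrange_identity hν zero_le_one (continuous_regA h1 k).continuousOn
    (continuous_regA h1 l).continuousOn (continuous_regQ h1 k).continuousOn
    (continuous_regQ h1 l).continuousOn (fun x hx => isBesselSol_reg h1 k hx.1)
    (fun x hx => isBesselSol_reg h1 l hx.1), regQ_zero h1, regQ_zero h1]
  ring

lemma regQ_one_eq_integral {ν : ℝ} (hν : -(1 / 2 : ℝ) < ν) (k : 𝕜) :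
    regQ ν k 1 = k * ∫ x in (0 : ℝ)..1, (x ^ (2 * ν + 1)) • regA ν k x := by
  have h1 : -1 < ν := by linarith
  have := lagrange_identity (k := k) (l := (0 : 𝕜)) (g := fun _ => 1) (qg := fun _ => 0) hν
    zero_le_one (continuous_regA h1 k).continuousOn continuousOn_const
    (continuous_regQ h1 k).continuousOn continuousOn_const
    (fun x hx => isBesselSol_reg h1 k hx.1) (fun x _ => by
      constructor <;> simpa using hasDerivAt_const x (_ : 𝕜))
  simpa [regQ_zero h1] using this.symm

end RCLike

lemma continuous_regA_normSq {ν : ℝ} (hν : -1 < ν) (z : ℂ) :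
    Continuous fun x => ‖regA ν z x‖ ^ 2 := (continuous_regA hν z).norm.pow 2

lemma conj_regA (ν : ℝ) (z : ℂ) (x : ℝ) :
    (starRingEnd ℂ) (regA ν z x) = regA ν ((starRingEnd ℂ) z) x := by
  unfold regA bes
  rw [Complex.conj_tsum]
  simp

lemma conj_regQ (ν : ℝ) (z : ℂ) (x : ℝ) :
    (starRingEnd ℂ) (regQ ν z x) = regQ ν ((starRingEnd ℂ) z) x := by
  have := conj_regA (ν + 1) z x
  unfold regA at this
  unfold regQ
  have h2 : (starRingEnd ℂ) 2 = 2 := Complex.conj_ofReal 2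
  rw [Complex.real_smul, Complex.real_smul, map_mul, map_mul, this]
  simp [h2]

lemma regA_zero {𝕜 : Type*} [RCLike 𝕜] (ν : ℝ) (k : 𝕜) : regA ν k 0 = (besC ν 0 : 𝕜) := by
  unfold regA bes
  rw [tsum_eq_single 0]
  · simp
  · intro m hm; simp [hm]

lemma integral_normSq_regA_pos {ν : ℝ} (hν : -(1 / 2 : ℝ) < ν) (z : ℂ) :
    0 < ∫ x in (0 : ℝ)..1, x ^ (2 * ν + 1) * ‖regA ν z x‖ ^ 2 := by
  have h1 : -1 < ν := by linarith
  have hc : Continuous fun x => x ^ (2 * ν + 1) * ‖regA ν z x‖ ^ 2 :=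
    (continuous_weight hν).mul (continuous_regA_normSq h1 z)
  have h0 : ‖regA ν z 0‖ ≠ 0 := by
    rw [regA_zero]
    simpa using (besC_pos h1 0).ne'
  have hev : ∀ᶠ x in 𝓝 (0 : ℝ), ‖regA ν z x‖ ≠ 0 :=
    (continuous_regA h1 z).norm.continuousAt.eventually_ne h0
  have hev2 : ∀ᶠ x in 𝓝[>] (0 : ℝ), ‖regA ν z x‖ ≠ 0 ∧ x < 1 ∧ 0 < x :=
    (hev.filter_mono nhdsWithin_le_nhds).and
      (((eventually_lt_nhds one_pos).filter_mono nhdsWithin_le_nhds).and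
        eventually_mem_nhdsWithin)
  obtain ⟨c, hc1, hc2, hc3⟩ := hev2.exists
  refine intervalIntegral.integral_pos one_pos hc.continuousOn (fun x hx => ?_)
    ⟨c, ⟨hc3.le, hc2.le⟩, ?_⟩
  · have := Real.rpow_nonneg hx.1.le (2 * ν + 1)
    positivity
  · have := Real.rpow_pos_of_pos hc3 (2 * ν + 1)
    positivity

lemma integral_regA_mul_conj {ν : ℝ} (z : ℂ) :
    ∫ x in (0 : ℝ)..1, (x ^ (2 * ν + 1)) • (regA ν z x * regA ν ((starRingEnd ℂ) z) x) =
      ((∫ x in (0 : ℝ)..1, x ^ (2 * ν + 1) * ‖regA ν z x‖ ^ 2 : ℝ) : ℂ) := by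
  rw [← intervalIntegral.integral_ofReal]
  congr 1
  ext x
  rw [← conj_regA, Complex.mul_conj, Complex.normSq_eq_norm_sq, Complex.real_smul]
  push_cast
  rfl

lemma regA_normSq_identity {ν : ℝ} (hν : -(1 / 2 : ℝ) < ν) (z : ℂ) :
    z.im * ∫ x in (0 : ℝ)..1, x ^ (2 * ν + 1) * ‖regA ν z x‖ ^ 2 =
      (regQ ν z 1 * (starRingEnd ℂ) (regA ν z 1)).im := by
  have h := lagrange_reg hν z ((starRingEnd ℂ) z)
  rw [integral_regA_mul_conj, ← conj_regA, ← conj_regQ, Complex.sub_conj] at h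
  have := congrArg Complex.im h
  simp at this ⊢
  linarith

lemma bes_ne_zero_of_im_ne_zero {ν : ℝ} (hν : -(1 / 2 : ℝ) < ν) {z : ℂ} (hz : z.im ≠ 0) :
    bes ν z ≠ 0 := by
  intro h
  have h2 := regA_normSq_identity hν z
  rw [regA_one, h, map_zero, mul_zero, Complex.zero_im] at h2
  exact mul_ne_zero hz (integral_normSq_regA_pos hν z).ne' h2

lemma bes_neg_sq_eq_zero {ν : ℝ} {Λ : ℕ → ℝ} (hΛ : IsPositiveZerosOfBesselJ ν Λ) (n : ℕ) :
    bes ν (-(Λ n) ^ 2) = 0 := by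
  have h1 := hΛ.2.1 n
  have h2 := hΛ.2.2.1 n
  rw [besselJ_eq h1] at h2
  exact (mul_eq_zero.1 h2).resolve_left (Real.rpow_pos_of_pos (by positivity) _).ne'

lemma exists_eq_of_bes_eq_zero {ν : ℝ} (hν : -(1 / 2 : ℝ) < ν) {Λ : ℕ → ℝ}
    (hΛ : IsPositiveZerosOfBesselJ ν Λ) {z : ℂ} (hz : bes ν z = 0) :
    ∃ n, z = ((-(Λ n) ^ 2 : ℝ) : ℂ) := by
  have him : z.im = 0 := by
    by_contra h
    exact bes_ne_zero_of_im_ne_zero hν h hz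
  obtain ⟨x, rfl⟩ : ∃ x : ℝ, z = (x : ℂ) := ⟨z.re, Complex.ext rfl (by simpa using him)⟩
  have hx : bes ν x = 0 := by
    have := ofReal_bes (𝕜 := ℂ) ν x
    exact Complex.ofReal_eq_zero.1 (this.trans hz)
  have hneg : x < 0 := by
    by_contra h
    exact (bes_pos (by linarith) (not_lt.1 h)).ne' hx
  have hs : 0 < √(-x) := Real.sqrt_pos.2 (by linarith)
  have hsq : -(√(-x)) ^ 2 = x := by rw [Real.sq_sqrt (by linarith)]; ring
  obtain ⟨n, hn⟩ := hΛ.2.2.2 (√(-x)) hs (by rw [besselJ_eq hs, hsq, hx, mul_zero])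
  exact ⟨n, by rw [hn, hsq]⟩

lemma continuous_integral_regA_mul {ν : ℝ} (hν : -(1 / 2 : ℝ) < ν) (l : ℝ) :
    Continuous fun k : ℝ => ∫ x in (0 : ℝ)..1, (x ^ (2 * ν + 1)) • (regA ν k x * regA ν l x) := by
  have h1 : -1 < ν := by linarith
  refine intervalIntegral.continuous_parametric_intervalIntegral_of_continuous' ?_ 0 1
  have hA : Continuous fun p : ℝ × ℝ => regA ν p.1 p.2 :=
    (continuous_bes h1).comp
      (continuous_fst.mul ((RCLike.continuous_ofReal.comp continuous_snd).pow 2))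
  exact ((continuous_weight hν).comp continuous_snd).smul
    (hA.mul ((continuous_regA h1 l).comp continuous_snd))

/-- Squared norms of the eigenfunctions. -/
noncomputable def eigN (ν k : ℝ) : ℝ := ∫ x in (0 : ℝ)..1, x ^ (2 * ν + 1) * regA ν k x ^ 2

lemma eigN_pos {ν : ℝ} (hν : -(1 / 2 : ℝ) < ν) (k : ℝ) : 0 < eigN ν k := by
  have := integral_normSq_regA_pos hν (k : ℂ)
  unfold eigN
  convert this using 4 with x
  have h2 : regA ν (k : ℂ) x = ((regA ν k x : ℝ) : ℂ) := by
    have := ofReal_bes (𝕜 := ℂ) ν (k * x ^ 2)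
    simp only [regA]
    simpa using this.symm
  rw [h2, Complex.norm_real, Real.norm_eq_abs, sq_abs]

lemma eigN_eq {ν : ℝ} (hν : -(1 / 2 : ℝ) < ν) {w : ℝ} (hw : bes ν w = 0) :
    eigN ν w = -(w / 8) * bes (ν + 1) w ^ 2 := by
  have h1 : -1 < ν := by linarith
  have hc := (continuous_integral_regA_mul hν w).tendsto w
  have hs := (hasDerivAt_iff_tendsto_slope.1 (bes_hasDerivAt (𝕜 := ℝ) h1 w))
  have hc' : Tendsto (fun k : ℝ => ∫ x in (0 : ℝ)..1,
      (x ^ (2 * ν + 1)) • (regA ν k x * regA ν w x)) (𝓝[≠] w) (𝓝 (eigN ν w)) := by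
    refine (hc.mono_left nhdsWithin_le_nhds).congr' ?_ |>.trans (le_of_eq ?_)
    · exact EventuallyEq.rfl
    · unfold eigN
      simp only [smul_eq_mul, pow_two]
  have h2 : Tendsto (fun k : ℝ => ∫ x in (0 : ℝ)..1,
      (x ^ (2 * ν + 1)) • (regA ν k x * regA ν w x)) (𝓝[≠] w)
      (𝓝 (bes (ν + 1) w / 4 * (-regQ ν w 1))) := by
    refine (hs.mul_const (-regQ ν w 1)).congr' ?_
    filter_upwards [self_mem_nhdsWithin] with k hk
    have hk' : k - w ≠ 0 := sub_ne_zero.2 hk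
    have h := lagrange_reg hν k w
    rw [regA_one, regA_one, hw, mul_zero, zero_sub] at h
    rw [slope_def_field, hw, sub_zero]
    field_simp
    linarith
  have h3 := tendsto_nhds_unique hc' h2
  rw [h3, regQ_one]
  ring

lemma integral_regA_mul_eq_zero {ν : ℝ} (hν : -(1 / 2 : ℝ) < ν) {k l : ℝ} (hkl : k ≠ l)
    (hk : bes ν k = 0) (hl : bes ν l = 0) :
    ∫ x in (0 : ℝ)..1, x ^ (2 * ν + 1) * (regA ν k x * regA ν l x) = 0 := by
  have h := lagrange_reg hν k l
  rw [regA_one, regA_one, hk, hl, mul_zero, zero_mul, sub_zero] at h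
  exact (mul_eq_zero.1 h).resolve_left (sub_ne_zero.2 hkl)

lemma bes_succ_ne_zero {ν : ℝ} (hν : -(1 / 2 : ℝ) < ν) {w : ℝ} (hw : bes ν w = 0) :
    bes (ν + 1) w ≠ 0 := by
  intro h
  have := eigN_pos hν w
  rw [eigN_eq hν hw, h] at this
  simp at this

lemma phiFB_mul_phiFB {ν : ℝ} (hν : -(1 / 2 : ℝ) < ν) {Λ : ℕ → ℝ}
    (hΛ : IsPositiveZerosOfBesselJ ν Λ) (n : ℕ) {x y : ℝ} (hx : 0 < x) (hy : 0 < y) :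
    phiFB ν Λ n x * phiFB ν Λ n y =
      regA ν (-(Λ n) ^ 2) x * regA ν (-(Λ n) ^ 2) y / eigN ν (-(Λ n) ^ 2) / Λ n := by
  have hL := hΛ.2.1 n
  have hz := bes_neg_sq_eq_zero hΛ n
  have hb := bes_succ_ne_zero hν hz
  rw [eigN_eq hν hz]
  have key : ∀ {x : ℝ}, 0 < x → phiFB ν Λ n x =
      √2 * √(Λ n) * (2 / ((Λ n) ^ 2 * |bes (ν + 1) (-(Λ n) ^ 2)|)) * regA ν (-(Λ n) ^ 2) x := by
    intro x hx
    unfold phiFB regA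
    have hp : 0 < (Λ n / 2) ^ ν := Real.rpow_pos_of_pos (by positivity) _
    rw [besselJ_eq hL, besselJ_eq (mul_pos hL hx), show Λ n * x / 2 = Λ n / 2 * x by ring,
      Real.mul_rpow (by positivity) hx.le, Real.rpow_neg hx.le,
      Real.rpow_add_one (by positivity : Λ n / 2 ≠ 0), abs_mul, abs_mul, abs_mul,
      abs_of_pos hL, abs_of_pos hp, abs_of_pos (by positivity : 0 < Λ n / 2)]
    have hx2 : x ^ ν ≠ 0 := (Real.rpow_pos_of_pos hx _).ne'
    have hb' := abs_ne_zero.2 hb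
    simp only [RCLike.ofReal_real_eq_id, id]
    rw [show -(Λ n * x) ^ 2 = -(Λ n) ^ 2 * x ^ 2 by ring]
    field_simp
  rw [key hx, key hy]
  have h2 : √2 * √2 = (2 : ℝ) := Real.mul_self_sqrt (by norm_num)
  have h3 : √(Λ n) * √(Λ n) = Λ n := Real.mul_self_sqrt hL.le
  have h4 : |bes (ν + 1) (-(Λ n) ^ 2)| * |bes (ν + 1) (-(Λ n) ^ 2)| =
    bes (ν + 1) (-(Λ n) ^ 2) ^ 2 := by
    rw [abs_mul_abs_self, ← pow_two]
  generalize bes (ν + 1) (-(Λ n) ^ 2) = b at *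
  have hb2 : b ^ 2 ≠ 0 := by positivity
  calc _ = (√2 * √2) * (√(Λ n) * √(Λ n)) * (4 / ((Λ n) ^ 4 * (|b| * |b|))) *
        (regA ν (-(Λ n) ^ 2) x * regA ν (-(Λ n) ^ 2) y) := by
        field_simp; ring
    _ = _ := by
        rw [h2, h3, h4]
        field_simp
        ring

lemma muMeas_absolutelyContinuous (ν : ℝ) : muMeas ν ≪ volume.restrict (Ioo 0 1) :=
  withDensity_absolutelyContinuous _ _

lemma ae_mem_Ioo_muMeas (ν : ℝ) : ∀ᵐ x ∂(muMeas ν), x ∈ Ioo (0 : ℝ) 1 :=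
  (muMeas_absolutelyContinuous ν).ae_le (ae_restrict_mem measurableSet_Ioo)

lemma muMeas_univ_le {ν : ℝ} (hν : -(1 / 2 : ℝ) < ν) : muMeas ν univ ≤ 1 := by
  unfold muMeas
  rw [withDensity_apply _ MeasurableSet.univ, Measure.restrict_univ]
  calc _ ≤ ∫⁻ _ in Ioo (0 : ℝ) 1, 1 := by
        refine setLIntegral_mono' measurableSet_Ioo fun x hx => ?_
        rw [← ENNReal.ofReal_one]
        exact ENNReal.ofReal_le_ofReal (Real.rpow_le_one hx.1.le hx.2.le (by linarith))
    _ = 1 := by simp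

lemma isFiniteMeasure_muMeas {ν : ℝ} (hν : -(1 / 2 : ℝ) < ν) : IsFiniteMeasure (muMeas ν) :=
  ⟨(muMeas_univ_le hν).trans_lt ENNReal.one_lt_top⟩

lemma integral_muMeas {E : Type*} [NormedAddCommGroup E] [NormedSpace ℝ E] (ν : ℝ) (f : ℝ → E) :
    ∫ x, f x ∂(muMeas ν) = ∫ x in (0 : ℝ)..1, (x ^ (2 * ν + 1)) • f x := by
  unfold muMeas
  rw [integral_withDensity_eq_integral_toReal_smul (by fun_prop)
    (Eventually.of_forall fun x => ENNReal.ofReal_lt_top),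
    intervalIntegral.integral_of_le zero_le_one, integral_Ioc_eq_integral_Ioo]
  refine setIntegral_congr_fun measurableSet_Ioo fun x hx => ?_
  rw [ENNReal.toReal_ofReal (Real.rpow_nonneg hx.1.le _)]

lemma memLp_muMeas {E : Type*} [NormedAddCommGroup E] [SecondCountableTopology E]
    {ν : ℝ} (hν : -(1 / 2 : ℝ) < ν) {f : ℝ → E} (hf : ContinuousOn f (Icc 0 1)) (p : ℝ≥0∞) :
    MemLp f p (muMeas ν) := by
  have := isFiniteMeasure_muMeas hν
  obtain ⟨C, hC⟩ := isCompact_Icc.exists_bound_of_continuousOn hf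
  refine MemLp.of_bound ?_ C ?_
  · exact ((hf.mono Ioo_subset_Icc_self).aestronglyMeasurable measurableSet_Ioo).mono_ac
      (muMeas_absolutelyContinuous ν)
  · filter_upwards [ae_mem_Ioo_muMeas ν] with x hx using hC x (Ioo_subset_Icc_self hx)

lemma integral_norm_mul_norm_le {α E : Type*} [MeasurableSpace α] {μ : Measure α}
    [NormedAddCommGroup E] {f g : α → E} (hf : MemLp f 2 μ) (hg : MemLp g 2 μ) :
    ∫ a, ‖f a‖ * ‖g a‖ ∂μ ≤ √(∫ a, ‖f a‖ ^ 2 ∂μ) * √(∫ a, ‖g a‖ ^ 2 ∂μ) := by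
  have h2 : (2 : ℝ≥0∞) = ENNReal.ofReal 2 := by simp
  have := integral_mul_norm_le_Lp_mul_Lq (μ := μ) (p := 2) (q := 2) Real.HolderConjugate.two_two
    (h2 ▸ hf) (h2 ▸ hg)
  simpa [Real.sqrt_eq_rpow] using this

lemma exists_entire_quotient {H a : ℂ → ℂ} (hH : Differentiable ℂ H) (ha : Differentiable ℂ a)
    (hz : ∀ w, a w = 0 → H w = 0 ∧ deriv a w ≠ 0) :
    ∃ Q : ℂ → ℂ, Differentiable ℂ Q ∧ ∀ z, H z = Q z * a z := by
  classical
  let Q : ℂ → ℂ := fun z => if a z = 0 then deriv H z / deriv a z else H z / a z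
  refine ⟨Q, fun w => ?_, fun z => ?_⟩
  · by_cases hw : a w = 0
    · obtain ⟨hHw, hd⟩ := hz w hw
      have hds : ∀ f : ℂ → ℂ, Differentiable ℂ f → Differentiable ℂ (dslope f w) := fun f hf =>
        differentiableOn_univ.1 ((Complex.differentiableOn_dslope univ_mem).2 hf.differentiableOn)
      have hne : dslope a w w ≠ 0 := by rwa [dslope_same]
      refine ((hds H hH w).div (hds a ha w) hne).congr_of_eventuallyEq ?_
      filter_upwards [(hds a ha).continuous.continuousAt.eventually_ne hne] with z hzne
      rcases eq_or_ne z w with rfl | hzw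
      · simp [Q, hw]
      · have hzw' := sub_ne_zero.2 hzw
        have e1 : a z = (z - w) * dslope a w z := by
          rw [dslope_of_ne _ hzw, slope_def_field, hw, sub_zero]; field_simp
        have e2 : H z = (z - w) * dslope H w z := by
          rw [dslope_of_ne _ hzw, slope_def_field, hHw, sub_zero]; field_simp
        have : a z ≠ 0 := by rw [e1]; exact mul_ne_zero hzw' hzne
        simp only [Q, this, if_false, Pi.div_apply]
        rw [e1, e2, mul_div_mul_left _ _ hzw']
    · refine ((hH w).div (ha w) hw).congr_of_eventuallyEq ?_
      filter_upwards [ha.continuous.continuousAt.eventually_ne hw] with z hz'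
      simp [Q, hz']
  · by_cases h : a z = 0
    · rw [h, mul_zero, (hz z h).1]
    · simp [Q, h]

lemma exists_eq_const_of_norm_mul_abs_im_le {Q : ℂ → ℂ} (hQ : Differentiable ℂ Q) {C : ℝ}
    (hC : ∀ z, ‖Q z‖ * |z.im| ≤ C * ‖z‖) : ∃ q, ∀ z, Q z = q := by
  refine hQ.exists_const_forall_eq_of_bounded ?_
  refine isBounded_iff_forall_norm_le.2 ⟨8 * C / 3, ?_⟩
  rintro _ ⟨z, rfl⟩
  set R : ℝ := 2 * (‖z‖ + 1)
  have hz0 := norm_nonneg z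
  have hR : 0 < R := by positivity
  have hzR : ‖z‖ ≤ R / 2 := by simp only [R]; linarith
  have hm := Complex.norm_le_of_forall_mem_frontier_norm_le (f := fun w => Q w * (w ^ 2 - R ^ 2))
    (U := Metric.ball 0 R) (C := 2 * C * R ^ 2) Metric.isBounded_ball
    (Differentiable.diffContOnCl (by fun_prop)) (fun w hw => ?_) (z := z)
    (subset_closure (by simpa using by linarith))
  · have h1 : 3 / 4 * R ^ 2 ≤ ‖z ^ 2 - (R : ℂ) ^ 2‖ := by
      have := norm_sub_norm_le ((R : ℂ) ^ 2) (z ^ 2)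
      rw [norm_sub_rev, norm_pow, norm_pow, Complex.norm_real, Real.norm_of_nonneg hR.le] at this
      nlinarith
    rw [norm_mul] at hm
    have h2 := (mul_le_mul_of_nonneg_left h1 (norm_nonneg (Q z))).trans hm
    have hR2 : 0 < R ^ 2 := by positivity
    by_contra! h
    nlinarith
  · rw [frontier_ball _ hR.ne', mem_sphere_zero_iff_norm] at hw
    have h1 : w ^ 2 - (R : ℂ) ^ 2 = w * (2 * w.im * Complex.I) := by
      have h2 : (R : ℂ) ^ 2 = w * (starRingEnd ℂ) w := by
        rw [Complex.mul_conj, Complex.normSq_eq_norm_sq, hw]; push_cast; rfl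
      rw [h2, pow_two, ← mul_sub, Complex.sub_conj]
      push_cast
      ring
    have h3 := hC w
    simp only [norm_mul]
    rw [h1]
    simp only [norm_mul, Complex.norm_I, Complex.norm_real, Real.norm_eq_abs, hw] at h3 ⊢
    norm_num
    nlinarith

section Completeness
variable {ν : ℝ} {f : ℝ → ℝ}

lemma integrable_mul_pow (hf : Integrable f (muMeas ν)) (m : ℕ) :
    Integrable (fun x => f x * x ^ (2 * m)) (muMeas ν) := by
  refine hf.mul_bdd (c := 1) (by fun_prop) ?_
  filter_upwards [ae_mem_Ioo_muMeas ν] with x hx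
  rw [norm_pow, Real.norm_of_nonneg hx.1.le]
  exact pow_le_one₀ hx.1.le hx.2.le

lemma abs_integral_mul_pow_le (hf : Integrable f (muMeas ν)) (m : ℕ) :
    |∫ x, f x * x ^ (2 * m) ∂(muMeas ν)| ≤ ∫ x, |f x| ∂(muMeas ν) := by
  refine (abs_integral_le_integral_abs).trans ?_
  refine integral_mono_ae (integrable_mul_pow hf m).abs hf.abs ?_
  filter_upwards [ae_mem_Ioo_muMeas ν] with x hx
  rw [abs_mul, abs_pow, abs_of_pos hx.1]
  exact mul_le_of_le_one_right (abs_nonneg _) (pow_le_one₀ hx.1.le hx.2.le)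

lemma integral_mul_regA (hν : -(1 / 2 : ℝ) < ν) (hf : Integrable f (muMeas ν)) (z : ℂ) :
    ∫ x, (f x : ℂ) * regA ν z x ∂(muMeas ν) =
      ∑' m : ℕ, ((besC ν m * ∫ x, f x * x ^ (2 * m) ∂(muMeas ν) : ℝ) : ℂ) * z ^ m := by
  have h1 : -1 < ν := by linarith
  have hi : ∀ m : ℕ, Integrable (fun x => ((besC ν m : ℂ) * z ^ m) *
      ((f x * x ^ (2 * m) : ℝ) : ℂ)) (muMeas ν) := fun m =>
    ((integrable_mul_pow hf m).ofReal).const_mul _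
  have h := hasSum_integral_of_summable_integral_norm hi ?_
  · refine Eq.trans (integral_congr_ae (Eventually.of_forall fun x => ?_))
      (h.tsum_eq.symm.trans (tsum_congr fun m => ?_))
    · simp only [regA, bes]
      rw [← tsum_mul_left]
      refine tsum_congr fun m => ?_
      push_cast
      simp only [Complex.coe_algebraMap]
      rw [mul_pow, pow_mul]
      ring
    · rw [integral_const_mul, integral_complex_ofReal]
      push_cast
      ring
  · refine Summable.of_nonneg_of_le (fun m => by positivity) (fun m => ?_)
      ((summable_besC h1 ‖z‖).mul_right (∫ x, |f x| ∂(muMeas ν)))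
    simp_rw [norm_mul, norm_pow]
    rw [integral_const_mul, Complex.norm_real, Real.norm_of_nonneg (besC_pos h1 m).le]
    have := besC_pos h1 m
    gcongr ?_ * ?_
    simp_rw [Complex.norm_real]
    refine integral_mono_ae (integrable_mul_pow hf m).norm hf.abs ?_
    filter_upwards [ae_mem_Ioo_muMeas ν] with x hx
    rw [Real.norm_eq_abs, abs_mul, abs_pow, abs_of_pos hx.1]
    exact mul_le_of_le_one_right (abs_nonneg _) (pow_le_one₀ hx.1.le hx.2.le)

lemma norm_integral_mul_regA_le (hν : -(1 / 2 : ℝ) < ν) (hf : MemLp f 2 (muMeas ν)) (z : ℂ) :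
    ‖∫ x, (f x : ℂ) * regA ν z x ∂(muMeas ν)‖ * |z.im| ≤
      √(∫ x, |f x| ^ 2 ∂(muMeas ν)) * ‖z‖ * ‖bes ν z‖ := by
  have h1 : -1 < ν := by linarith
  have := isFiniteMeasure_muMeas hν
  set X := √(∫ x, ‖regA ν z x‖ ^ 2 ∂(muMeas ν)) with hX
  have hA : MemLp (regA ν z) 2 (muMeas ν) := memLp_muMeas hν (continuous_regA h1 z).continuousOn 2
  have hH : ‖∫ x, (f x : ℂ) * regA ν z x ∂(muMeas ν)‖ ≤ √(∫ x, |f x| ^ 2 ∂(muMeas ν)) * X := by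
    refine (norm_integral_le_integral_norm _).trans ?_
    have := integral_norm_mul_norm_le hf.ofReal hA
    simpa [norm_mul] using this
  have hone : ∫ x, ‖regA ν z x‖ ∂(muMeas ν) ≤ X := by
    have := integral_norm_mul_norm_le (memLp_const (1 : ℂ)) hA
    simp only [norm_one, one_mul, one_pow, integral_const, smul_eq_mul, mul_one] at this
    refine this.trans (mul_le_of_le_one_left (Real.sqrt_nonneg _) ?_)
    refine Real.sqrt_le_one.2 ?_
    exact ENNReal.toReal_le_of_le_ofReal zero_le_one (by simpa using muMeas_univ_le hν)
  have hXsq : X ^ 2 = ∫ x in (0 : ℝ)..1, x ^ (2 * ν + 1) * ‖regA ν z x‖ ^ 2 := by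
    rw [hX, Real.sq_sqrt (integral_nonneg fun x => by positivity), integral_muMeas]
    rfl
  have hXpos : 0 < X := by
    have := integral_normSq_regA_pos hν z
    rw [← hXsq] at this
    exact (Real.sqrt_nonneg _).lt_of_ne fun h => this.ne (by rw [hX, ← h]; norm_num)
  have hQ : ‖regQ ν z 1‖ ≤ ‖z‖ * X := by
    rw [regQ_one_eq_integral hν, norm_mul, ← integral_muMeas]
    gcongr
    exact (norm_integral_le_integral_norm _).trans hone
  have hid := regA_normSq_identity hν z
  rw [← hXsq, regA_one] at hid
  have h3 : |z.im| * X ^ 2 ≤ ‖z‖ * X * ‖bes ν z‖ := by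
    rw [← abs_of_nonneg (sq_nonneg X), ← abs_mul, hid]
    refine (Complex.abs_im_le_norm _).trans ?_
    rw [norm_mul, RCLike.norm_conj]
    gcongr
  have h4 : |z.im| * X ≤ ‖z‖ * ‖bes ν z‖ := by
    refine le_of_mul_le_mul_right ?_ hXpos
    linarith
  calc _ ≤ √(∫ x, |f x| ^ 2 ∂(muMeas ν)) * X * |z.im| := by gcongr
    _ = √(∫ x, |f x| ^ 2 ∂(muMeas ν)) * (|z.im| * X) := by ring
    _ ≤ √(∫ x, |f x| ^ 2 ∂(muMeas ν)) * (‖z‖ * ‖bes ν z‖) := by gcongr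
    _ = _ := by ring

lemma tendsto_integral_mul_pow (hf : Integrable f (muMeas ν)) :
    Tendsto (fun m : ℕ => ∫ x, f x * x ^ (2 * m) ∂(muMeas ν)) atTop (𝓝 0) := by
  have := tendsto_integral_of_dominated_convergence (μ := muMeas ν)
    (F := fun m x => f x * x ^ (2 * m)) (f := fun _ => 0)
    (fun x => |f x|) (fun m => (integrable_mul_pow hf m).1) hf.abs (fun m => ?_) ?_
  · simpa using this
  · filter_upwards [ae_mem_Ioo_muMeas ν] with x hx
    rw [Real.norm_eq_abs, abs_mul, abs_pow, abs_of_pos hx.1]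
    exact mul_le_of_le_one_right (abs_nonneg _) (pow_le_one₀ hx.1.le hx.2.le)
  · filter_upwards [ae_mem_Ioo_muMeas ν] with x hx
    have h2 := (tendsto_pow_atTop_nhds_zero_of_lt_one (sq_nonneg x)
      (pow_lt_one₀ hx.1.le hx.2 two_ne_zero)).const_mul (f x)
    simpa [pow_mul] using h2

lemma integral_mul_pow_eq_zero (hν : -(1 / 2 : ℝ) < ν) {Λ : ℕ → ℝ}
    (hΛ : IsPositiveZerosOfBesselJ ν Λ) (hf : MemLp f 2 (muMeas ν))
    (h0 : ∀ n, ∫ x, f x * regA ν (-(Λ n) ^ 2) x ∂(muMeas ν) = 0) (m : ℕ) :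
    ∫ x, f x * x ^ (2 * m) ∂(muMeas ν) = 0 := by
  have h1 : -1 < ν := by linarith
  have := isFiniteMeasure_muMeas hν
  have hfi : Integrable f (muMeas ν) := hf.integrable one_le_two
  set M : ℕ → ℝ := fun m => ∫ x, f x * x ^ (2 * m) ∂(muMeas ν) with hM
  set K := ∫ x, |f x| ∂(muMeas ν)
  have hMK : ∀ m, |M m| ≤ K := abs_integral_mul_pow_le hfi
  set H : ℂ → ℂ := fun z => ∫ x, (f x : ℂ) * regA ν z x ∂(muMeas ν) with hHdef
  have hHs : ∀ z, H z = ∑' m : ℕ, ((besC ν m * M m : ℝ) : ℂ) * z ^ m := integral_mul_regA hν hfi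
  have hHd : Differentiable ℂ H := by
    have h := (hasFPowerSeriesOnBall_of_le_besC h1 (M := K)
      (b := fun m => ((besC ν m * M m : ℝ) : ℂ)) fun m => ?_).differentiableOn
    · rw [← funext hHs] at h
      simpa [differentiableOn_univ] using h
    · rw [Complex.norm_real, norm_mul, Real.norm_of_nonneg (besC_pos h1 m).le, mul_comm]
      exact mul_le_mul_of_nonneg_right (hMK m) (besC_pos h1 m).le
  have had : Differentiable ℂ (bes ν : ℂ → ℂ) := fun z => (bes_hasDerivAt h1 z).differentiableAt
  obtain ⟨Q, hQ, hHQ⟩ := exists_entire_quotient hHd had (fun w hw => by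
    obtain ⟨n, rfl⟩ := exists_eq_of_bes_eq_zero hν hΛ hw
    constructor
    · have h2 : ∀ x, (f x : ℂ) * regA ν ((-(Λ n) ^ 2 : ℝ) : ℂ) x =
          ((f x * regA ν (-(Λ n) ^ 2) x : ℝ) : ℂ) := fun x => by
        have h3 := ofReal_bes (𝕜 := ℂ) ν (-(Λ n) ^ 2 * x ^ 2)
        simp only [regA]
        push_cast at h3 ⊢
        simp only [RCLike.ofReal_eq_complex_ofReal, RCLike.ofReal_real_eq_id, id] at h3 ⊢
        rw [h3]
      simp only [hHdef, h2]
      rw [integral_complex_ofReal, h0 n, Complex.ofReal_zero]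
    · rw [(bes_hasDerivAt h1 _).deriv]
      have h3 := ofReal_bes (𝕜 := ℂ) (ν + 1) (-(Λ n) ^ 2)
      simp only [RCLike.ofReal_eq_complex_ofReal] at h3
      rw [← h3]
      simpa using bes_succ_ne_zero hν (bes_neg_sq_eq_zero hΛ n))
  obtain ⟨q, hq⟩ := exists_eq_const_of_norm_mul_abs_im_le hQ
    (C := √(∫ x, |f x| ^ 2 ∂(muMeas ν))) (fun z => by
      rcases eq_or_ne z.im 0 with him | him
      · rw [him, abs_zero, mul_zero]; positivity
      · have h2 := norm_integral_mul_regA_le hν hf z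
        have h3 : ‖H z‖ * |z.im| ≤ _ := h2
        have h4 := norm_pos_iff.2 (bes_ne_zero_of_im_ne_zero hν him)
        rw [hHQ z, norm_mul] at h3
        refine le_of_mul_le_mul_right ?_ h4
        linarith)
  have hcoef : ∀ m, ((besC ν m * M m : ℝ) : ℂ) - (besC ν m : ℂ) * q = 0 := by
    refine eq_zero_of_tsum_eq_zero h1 (M := K + ‖q‖) (fun m => ?_) fun z => ?_
    · push_cast
      rw [← mul_sub, norm_mul, Complex.norm_real, Real.norm_of_nonneg (besC_pos h1 m).le, mul_comm]
      refine mul_le_mul_of_nonneg_right ?_ (besC_pos h1 m).le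
      refine (norm_sub_le _ _).trans ?_
      rw [Complex.norm_real]
      exact add_le_add_left (hMK m) _
    · have hs1 : Summable fun m => ((besC ν m * M m : ℝ) : ℂ) * z ^ m := by
        refine Summable.of_norm_bounded ((summable_besC h1 ‖z‖).mul_left K) fun m => ?_
        rw [norm_mul, Complex.norm_real, norm_mul, Real.norm_of_nonneg (besC_pos h1 m).le, norm_pow]
        have := besC_pos h1 m
        calc _ = |M m| * (besC ν m * ‖z‖ ^ m) := by rw [Real.norm_eq_abs]; ring
          _ ≤ _ := by gcongr; exact hMK m
      have hs2 : Summable fun m => (besC ν m : ℂ) * z ^ m * q := (summable_bes h1 z).mul_right q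
      have h5 := hHQ z
      rw [hHs, hq] at h5
      calc _ = ∑' m, (((besC ν m * M m : ℝ) : ℂ) * z ^ m - (besC ν m : ℂ) * z ^ m * q) :=
            tsum_congr fun m => by ring
        _ = _ := by
          rw [hs1.tsum_sub hs2, h5, tsum_mul_right]
          simp only [bes, RCLike.ofReal_eq_complex_ofReal]
          ring
  have hMq : ∀ m, (M m : ℂ) = q := fun m => by
    have h2 := hcoef m
    push_cast at h2
    rw [← mul_sub] at h2
    refine sub_eq_zero.1 ((mul_eq_zero.1 h2).resolve_left ?_)
    exact_mod_cast (besC_pos h1 m).ne'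
  have hM0 : Tendsto (fun _ : ℕ => M m) atTop (𝓝 0) := by
    refine (tendsto_integral_mul_pow hfi).congr fun k => ?_
    exact Complex.ofReal_injective ((hMq k).trans (hMq m).symm)
  exact tendsto_nhds_unique tendsto_const_nhds hM0

lemma ae_eq_zero_of_integral_mul_pow (hν : -(1 / 2 : ℝ) < ν) (hf : Integrable f (muMeas ν))
    (h0 : ∀ m : ℕ, ∫ x, f x * x ^ (2 * m) ∂(muMeas ν) = 0) : ∀ᵐ x ∂(muMeas ν), f x = 0 := by
  have := isFiniteMeasure_muMeas hν
  refine ae_eq_zero_of_integral_contDiff_smul_eq_zero hf.locallyIntegrable fun g hg _ => ?_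
  set K := ∫ x, |f x| ∂(muMeas ν)
  have hK : 0 ≤ K := integral_nonneg fun x => abs_nonneg _
  have hpoly : ∀ p : Polynomial ℝ, ∫ x, f x * p.eval (x ^ 2) ∂(muMeas ν) = 0 := by
    intro p
    simp_rw [Polynomial.eval_eq_sum_range, Finset.mul_sum, ← pow_mul]
    rw [integral_finsetSum]
    · refine Finset.sum_eq_zero fun i _ => ?_
      simp_rw [mul_left_comm (f _)]
      rw [integral_const_mul, h0, mul_zero]
    · intro i _
      simp_rw [mul_left_comm (f _)]
      exact (integrable_mul_pow hf i).const_mul _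
  have hgb : Integrable (fun x => g x • f x) (muMeas ν) := by
    simpa [mul_comm] using hf.mul_bdd (memLp_muMeas hν hg.continuous.continuousOn ⊤).1
      ((isCompact_Icc.exists_bound_of_continuousOn (s := Icc (0 : ℝ) 1)
        hg.continuous.continuousOn).choose_spec |> fun h => by
          filter_upwards [ae_mem_Ioo_muMeas ν] with x hx using h x (Ioo_subset_Icc_self hx))
  refine abs_nonpos_iff.1 (le_of_forall_pos_le_add fun ε hε => ?_)
  have hδ : 0 < ε / (K + 1) := by positivity
  obtain ⟨p, hp⟩ := exists_polynomial_near_of_continuousOn 0 1 (fun s => g √s)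
    (by have := hg.continuous; fun_prop) _ hδ
  have hpi : Integrable (fun x => f x * p.eval (x ^ 2)) (muMeas ν) := by
    simp_rw [Polynomial.eval_eq_sum_range, Finset.mul_sum, ← pow_mul]
    refine integrable_finsetSum _ fun i _ => ?_
    simp_rw [mul_left_comm (f _)]
    exact (integrable_mul_pow hf i).const_mul _
  rw [zero_add, ← sub_zero (∫ x, g x • f x ∂(muMeas ν)), ← hpoly p, ← integral_sub hgb hpi]
  refine abs_integral_le_integral_abs.trans ?_
  calc ∫ x, |g x • f x - f x * p.eval (x ^ 2)| ∂(muMeas ν)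
      ≤ ∫ x, |f x| * (ε / (K + 1)) ∂(muMeas ν) := by
        refine integral_mono_ae (hgb.sub hpi).abs (hf.abs.mul_const _) ?_
        filter_upwards [ae_mem_Ioo_muMeas ν] with x hx
        have h2 := hp (x ^ 2) ⟨by positivity, pow_le_one₀ hx.1.le hx.2.le⟩
        rw [Real.sqrt_sq hx.1.le, abs_sub_comm] at h2
        rw [smul_eq_mul, mul_comm (g x), ← mul_sub, abs_mul]
        gcongr
    _ = K * (ε / (K + 1)) := integral_mul_const _ _
    _ ≤ ε := by
        rw [mul_div_assoc', div_le_iff₀ (by positivity)]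
        nlinarith

end Completeness

/-- The `L²(μ)`-normalised eigenfunctions. -/
noncomputable def eigE (ν : ℝ) (Λ : ℕ → ℝ) (n : ℕ) (x : ℝ) : ℝ :=
  regA ν (-(Λ n) ^ 2) x / √(eigN ν (-(Λ n) ^ 2))

lemma continuous_eigE {ν : ℝ} (hν : -1 < ν) (Λ : ℕ → ℝ) (n : ℕ) : Continuous (eigE ν Λ n) :=
  (continuous_regA hν _).div_const _

lemma memLp_eigE {ν : ℝ} (hν : -(1 / 2 : ℝ) < ν) (Λ : ℕ → ℝ) (n : ℕ) :
    MemLp (eigE ν Λ n) 2 (muMeas ν) :=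
  memLp_muMeas hν (continuous_eigE (by linarith) Λ n).continuousOn 2

lemma inner_toLp {ν : ℝ} {f g : ℝ → ℝ} (hf : MemLp f 2 (muMeas ν)) (hg : MemLp g 2 (muMeas ν)) :
    inner ℝ (hf.toLp f) (hg.toLp g) = ∫ x, f x * g x ∂(muMeas ν) := by
  rw [L2.inner_def]
  refine integral_congr_ae ?_
  filter_upwards [hf.coeFn_toLp, hg.coeFn_toLp] with x h1 h2
  rw [h1, h2, real_inner_eq_re_inner, RCLike.inner_apply]
  simp [mul_comm]

lemma orthonormal_eigE {ν : ℝ} (hν : -(1 / 2 : ℝ) < ν) {Λ : ℕ → ℝ}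
    (hΛ : IsPositiveZerosOfBesselJ ν Λ) :
    Orthonormal ℝ fun n => (memLp_eigE hν Λ n).toLp (eigE ν Λ n) := by
  rw [orthonormal_iff_ite]
  intro i j
  have hi := eigN_pos hν (-(Λ i) ^ 2)
  have hj := eigN_pos hν (-(Λ j) ^ 2)
  have key : ∫ x, eigE ν Λ i x * eigE ν Λ j x ∂(muMeas ν) =
      (∫ x in (0 : ℝ)..1, x ^ (2 * ν + 1) * (regA ν (-(Λ i) ^ 2) x * regA ν (-(Λ j) ^ 2) x)) /
        (√(eigN ν (-(Λ i) ^ 2)) * √(eigN ν (-(Λ j) ^ 2))) := by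
    rw [integral_muMeas, ← intervalIntegral.integral_div]
    refine intervalIntegral.integral_congr fun x _ => ?_
    simp only [eigE, smul_eq_mul]
    field_simp
  rw [inner_toLp, key]
  split_ifs with hij
  · subst hij
    rw [Real.mul_self_sqrt hi.le, div_eq_one_iff_eq hi.ne']
    simp only [eigN, pow_two]
  · rw [integral_regA_mul_eq_zero hν _ (bes_neg_sq_eq_zero hΛ i) (bes_neg_sq_eq_zero hΛ j),
      zero_div]
    intro h
    refine hij (hΛ.1.injective ?_)
    have := hΛ.2.1 i
    have := hΛ.2.1 j
    nlinarith

lemma span_eigE_orthogonal {ν : ℝ} (hν : -(1 / 2 : ℝ) < ν) {Λ : ℕ → ℝ}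
    (hΛ : IsPositiveZerosOfBesselJ ν Λ) :
    (Submodule.span ℝ (range fun n => (memLp_eigE hν Λ n).toLp (eigE ν Λ n)))ᗮ = ⊥ := by
  have := isFiniteMeasure_muMeas hν
  rw [Submodule.eq_bot_iff]
  intro f hf
  have h0 : ∀ n, ∫ x, f x * regA ν (-(Λ n) ^ 2) x ∂(muMeas ν) = 0 := by
    intro n
    have h := (Submodule.mem_orthogonal _ _).1 hf _ (Submodule.subset_span (mem_range_self n))
    have h2 : f = (Lp.memLp f).toLp f := (Lp.toLp_coeFn f (Lp.memLp f)).symm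
    rw [h2, inner_toLp] at h
    have hs := (Real.sqrt_pos.2 (eigN_pos hν (-(Λ n) ^ 2))).ne'
    have h3 : ∀ x, f x * regA ν (-(Λ n) ^ 2) x =
        √(eigN ν (-(Λ n) ^ 2)) * (eigE ν Λ n x * f x) := fun x => by
      unfold eigE; field_simp
    simp_rw [h3]
    rw [integral_const_mul, h, mul_zero]
  have h1 := integral_mul_pow_eq_zero hν hΛ (Lp.memLp f) h0
  have h2 := ae_eq_zero_of_integral_mul_pow hν ((Lp.memLp f).integrable one_le_two) h1
  exact (Lp.eq_zero_iff_ae_eq_zero).2 h2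

lemma hasSum_parseval {ν : ℝ} (hν : -(1 / 2 : ℝ) < ν) {Λ : ℕ → ℝ}
    (hΛ : IsPositiveZerosOfBesselJ ν Λ) {f g : ℝ → ℝ} (hf : MemLp f 2 (muMeas ν))
    (hg : MemLp g 2 (muMeas ν)) :
    HasSum (fun n => (∫ x, f x * eigE ν Λ n x ∂(muMeas ν)) *
      ∫ x, g x * eigE ν Λ n x ∂(muMeas ν)) (∫ x, f x * g x ∂(muMeas ν)) := by
  let b := HilbertBasis.mkOfOrthogonalEqBot (orthonormal_eigE hν hΛ) (span_eigE_orthogonal hν hΛ)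
  have hb : ⇑b = fun n => (memLp_eigE hν Λ n).toLp (eigE ν Λ n) :=
    HilbertBasis.coe_mkOfOrthogonalEqBot _ _
  have h := b.hasSum_inner_mul_inner (hf.toLp f) (hg.toLp g)
  rw [inner_toLp, hb] at h
  refine Eq.mp (congrArg (fun F => HasSum F _) (funext fun n => ?_)) h
  rw [real_inner_comm (hg.toLp g), inner_toLp, inner_toLp]

section Green
variable {ν : ℝ}

lemma regA_pos (hν : -1 < ν) {k : ℝ} (hk : 0 ≤ k) (x : ℝ) : 0 < regA ν k x :=
  bes_pos hν (by simp only [RCLike.ofReal_real_eq_id, id]; positivity)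

lemma continuousOn_inv_weight_mul_regA_sq (hν : -1 < ν) {k : ℝ} (hk : 0 ≤ k) :
    ContinuousOn (fun s : ℝ => (s ^ (2 * ν + 1) * regA ν k s ^ 2)⁻¹) (Ioi 0) := by
  refine ContinuousOn.inv₀ (ContinuousOn.mul ?_ ((continuous_regA hν k).pow 2).continuousOn) ?_
  · exact fun x hx => (Real.continuousAt_rpow_const x _ (Or.inl (ne_of_gt hx))).continuousWithinAt
  · intro x hx
    exact mul_ne_zero (Real.rpow_pos_of_pos hx _).ne' (pow_ne_zero _ (regA_pos hν hk x).ne')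

/-- The reduction-of-order integral. -/
noncomputable def regD (ν k y : ℝ) : ℝ := ∫ s in y..1, (s ^ (2 * ν + 1) * regA ν k s ^ 2)⁻¹

/-- The solution of `(x^{2ν+1} f′)′ = k x^{2ν+1} f` vanishing at `1`. -/
noncomputable def regB (ν k y : ℝ) : ℝ := regA ν k y * regD ν k y

/-- The quasi-derivative of `regB`. -/
noncomputable def regBQ (ν k y : ℝ) : ℝ := regQ ν k y * regD ν k y - (regA ν k y)⁻¹

lemma intervalIntegrable_regD (hν : -1 < ν) {k : ℝ} (hk : 0 ≤ k) {a b : ℝ} (ha : 0 < a)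
    (hb : 0 < b) :
    IntervalIntegrable (fun s : ℝ => (s ^ (2 * ν + 1) * regA ν k s ^ 2)⁻¹) volume a b := by
  refine ContinuousOn.intervalIntegrable ((continuousOn_inv_weight_mul_regA_sq hν hk).mono ?_)
  intro s hs
  exact lt_of_lt_of_le (lt_min ha hb) hs.1

lemma hasDerivAt_regD (hν : -1 < ν) {k : ℝ} (hk : 0 ≤ k) {y : ℝ} (hy : 0 < y) :
    HasDerivAt (regD ν k) (-(y ^ (2 * ν + 1) * regA ν k y ^ 2)⁻¹) y :=
  intervalIntegral.integral_hasDerivAt_left (intervalIntegrable_regD hν hk hy one_pos)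
    ((continuousOn_inv_weight_mul_regA_sq hν hk).stronglyMeasurableAtFilter isOpen_Ioi y hy)
    ((continuousOn_inv_weight_mul_regA_sq hν hk).continuousAt (Ioi_mem_nhds hy))

lemma isBesselSol_regB (hν : -1 < ν) {k : ℝ} (hk : 0 ≤ k) {y : ℝ} (hy : 0 < y) :
    IsBesselSol ν k (regB ν k) (regBQ ν k) y := by
  obtain ⟨h1, h2⟩ := isBesselSol_reg hν k hy
  have hD := hasDerivAt_regD hν hk hy
  have hA := (regA_pos hν hk y).ne'
  have hp := (Real.rpow_pos_of_pos hy (2 * ν + 1)).ne'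
  constructor
  · refine (h1.mul hD).congr_deriv ?_
    simp only [regBQ, smul_eq_mul]
    field_simp
    ring
  · refine ((h2.mul hD).sub (h1.inv hA)).congr_deriv ?_
    simp only [regB, smul_eq_mul]
    field_simp
    ring

lemma continuousOn_regB (hν : -1 < ν) {k : ℝ} (hk : 0 ≤ k) : ContinuousOn (regB ν k) (Ioi 0) :=
  fun _ hx => (isBesselSol_regB hν hk hx).1.continuousAt.continuousWithinAt

lemma continuousOn_regBQ (hν : -1 < ν) {k : ℝ} (hk : 0 ≤ k) : ContinuousOn (regBQ ν k) (Ioi 0) :=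
  fun _ hx => (isBesselSol_regB hν hk hx).2.continuousAt.continuousWithinAt

lemma regB_one (ν k : ℝ) : regB ν k 1 = 0 := by simp [regB, regD]

lemma regD_nonneg {k y : ℝ} (hy : 0 < y) (hy1 : y ≤ 1) :
    0 ≤ regD ν k y :=
  intervalIntegral.integral_nonneg hy1 fun s hs => by
    have := Real.rpow_nonneg (hy.le.trans hs.1) (2 * ν + 1)
    positivity

lemma wronskian_reg (hν : -1 < ν) {k : ℝ} (hk : 0 ≤ k) (y : ℝ) :
    regQ ν k y * regB ν k y - regA ν k y * regBQ ν k y = 1 := by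
  have hA := (regA_pos hν hk y).ne'
  simp only [regB, regBQ]
  field_simp
  ring

/-- The Green function of the Bessel operator with spectral parameter `-k`. -/
noncomputable def greenG (ν k x y : ℝ) : ℝ := regA ν k (min x y) * regB ν k (max x y)

lemma continuous_greenG (hν : -1 < ν) {k : ℝ} (hk : 0 ≤ k) {x : ℝ} (hx : 0 < x) :
    Continuous (greenG ν k x) := by
  refine ((continuous_regA hν k).comp (by fun_prop)).mul ?_
  exact (continuousOn_regB hν hk).comp_continuous (by fun_prop)
    fun y => lt_of_lt_of_le hx (le_max_left _ _)

lemma integral_greenG_mul_regA (hν : -(1 / 2 : ℝ) < ν) {k : ℝ} (hk : 0 ≤ k) {x : ℝ}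
    (hx : x ∈ Ioo (0 : ℝ) 1) {w : ℝ} (hw : bes ν w = 0) :
    (k - w) * ∫ s, greenG ν k x s * regA ν w s ∂(muMeas ν) = regA ν w x := by
  have h1 : -1 < ν := by linarith
  have hA := continuous_regA (𝕜 := ℝ) h1
  have hQ := continuous_regQ (𝕜 := ℝ) h1
  have hB := continuousOn_regB h1 hk
  have hBQ := continuousOn_regBQ h1 hk
  have hsub : Icc x 1 ⊆ Ioi 0 := fun s hs => hx.1.trans_le hs.1
  have hc : Continuous fun s => s ^ (2 * ν + 1) • (greenG ν k x s * regA ν w s) :=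
    (continuous_weight hν).smul ((continuous_greenG h1 hk hx.1).mul (hA w))
  have e1 := lagrange_identity hν hx.1.le (hA k).continuousOn (hA w).continuousOn
    (hQ k).continuousOn (hQ w).continuousOn (fun s hs => isBesselSol_reg h1 k hs.1)
    (fun s hs => isBesselSol_reg h1 w hs.1)
  have e2 := lagrange_identity hν hx.2.le (hB.mono hsub) (hA w).continuousOn
    (hBQ.mono hsub) (hQ w).continuousOn
    (fun s hs => isBesselSol_regB h1 hk (hx.1.trans hs.1))
    (fun s hs => isBesselSol_reg h1 w (hx.1.trans hs.1))
  rw [regQ_zero h1, regQ_zero h1] at e1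
  rw [regB_one, regA_one, hw] at e2
  have i1 : ∫ s in (0 : ℝ)..x, s ^ (2 * ν + 1) • (greenG ν k x s * regA ν w s) =
      regB ν k x * ∫ s in (0 : ℝ)..x, s ^ (2 * ν + 1) • (regA ν k s * regA ν w s) := by
    rw [← intervalIntegral.integral_const_mul]
    refine intervalIntegral.integral_congr fun s hs => ?_
    rw [uIcc_of_le hx.1.le] at hs
    simp only [greenG, min_eq_right hs.2, max_eq_left hs.2, smul_eq_mul]
    ring
  have i2 : ∫ s in x..1, s ^ (2 * ν + 1) • (greenG ν k x s * regA ν w s) =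
      regA ν k x * ∫ s in x..1, s ^ (2 * ν + 1) • (regB ν k s * regA ν w s) := by
    rw [← intervalIntegral.integral_const_mul]
    refine intervalIntegral.integral_congr fun s hs => ?_
    rw [uIcc_of_le hx.2.le] at hs
    simp only [greenG, min_eq_left hs.1, max_eq_right hs.1, smul_eq_mul]
    ring
  rw [integral_muMeas, ← intervalIntegral.integral_add_adjacent_intervals
    (hc.intervalIntegrable 0 x) (hc.intervalIntegrable x 1), i1, i2]
  linear_combination regB ν k x * e1 + regA ν k x * e2 + regA ν w x * wronskian_reg h1 hk x

lemma integral_greenG_mul_greenG (hν : -(1 / 2 : ℝ) < ν) {k l : ℝ} (hk : 0 ≤ k) (hl : 0 ≤ l)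
    {x y : ℝ} (hx : 0 < x) (hxy : x ≤ y) (hy : y < 1) :
    (k - l) * ∫ s, greenG ν k x s * greenG ν l y s ∂(muMeas ν) =
      greenG ν l x y - greenG ν k x y := by
  have h1 : -1 < ν := by linarith
  have hA := continuous_regA (𝕜 := ℝ) h1
  have hQ := continuous_regQ (𝕜 := ℝ) h1
  have hB := fun {k : ℝ} (hk : 0 ≤ k) => continuousOn_regB h1 hk
  have hBQ := fun {k : ℝ} (hk : 0 ≤ k) => continuousOn_regBQ h1 hk
  have hy0 : 0 < y := hx.trans_le hxy
  have hsub : Icc x y ⊆ Ioi 0 := fun s hs => hx.trans_le hs.1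
  have hsub' : Icc y 1 ⊆ Ioi 0 := fun s hs => hy0.trans_le hs.1
  have hc : Continuous fun s => s ^ (2 * ν + 1) • (greenG ν k x s * greenG ν l y s) :=
    (continuous_weight hν).smul ((continuous_greenG h1 hk hx).mul
      (continuous_greenG h1 hl hy0))
  have e1 := lagrange_identity hν hx.le (hA k).continuousOn (hA l).continuousOn
    (hQ k).continuousOn (hQ l).continuousOn (fun s hs => isBesselSol_reg h1 k hs.1)
    (fun s hs => isBesselSol_reg h1 l hs.1)
  have e2 := lagrange_identity hν hxy ((hB hk).mono hsub) (hA l).continuousOn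
    ((hBQ hk).mono hsub) (hQ l).continuousOn
    (fun s hs => isBesselSol_regB h1 hk (hx.trans hs.1))
    (fun s hs => isBesselSol_reg h1 l (hx.trans hs.1))
  have e3 := lagrange_identity hν hy.le ((hB hk).mono hsub') ((hB hl).mono hsub')
    ((hBQ hk).mono hsub') ((hBQ hl).mono hsub')
    (fun s hs => isBesselSol_regB h1 hk (hy0.trans hs.1))
    (fun s hs => isBesselSol_regB h1 hl (hy0.trans hs.1))
  rw [regQ_zero h1, regQ_zero h1] at e1
  rw [regB_one, regB_one] at e3
  have i1 : ∫ s in (0 : ℝ)..x, s ^ (2 * ν + 1) • (greenG ν k x s * greenG ν l y s) =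
      regB ν k x * regB ν l y *
        ∫ s in (0 : ℝ)..x, s ^ (2 * ν + 1) • (regA ν k s * regA ν l s) := by
    rw [← intervalIntegral.integral_const_mul]
    refine intervalIntegral.integral_congr fun s hs => ?_
    rw [uIcc_of_le hx.le] at hs
    simp only [greenG, min_eq_right hs.2, max_eq_left hs.2, min_eq_right (hs.2.trans hxy),
      max_eq_left (hs.2.trans hxy), smul_eq_mul]
    ring
  have i2 : ∫ s in x..y, s ^ (2 * ν + 1) • (greenG ν k x s * greenG ν l y s) =
      regA ν k x * regB ν l y * ∫ s in x..y, s ^ (2 * ν + 1) • (regB ν k s * regA ν l s) := by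
    rw [← intervalIntegral.integral_const_mul]
    refine intervalIntegral.integral_congr fun s hs => ?_
    rw [uIcc_of_le hxy] at hs
    simp only [greenG, min_eq_left hs.1, max_eq_right hs.1, min_eq_right hs.2,
      max_eq_left hs.2, smul_eq_mul]
    ring
  have i3 : ∫ s in y..1, s ^ (2 * ν + 1) • (greenG ν k x s * greenG ν l y s) =
      regA ν k x * regA ν l y * ∫ s in y..1, s ^ (2 * ν + 1) • (regB ν k s * regB ν l s) := by
    rw [← intervalIntegral.integral_const_mul]
    refine intervalIntegral.integral_congr fun s hs => ?_
    rw [uIcc_of_le hy.le] at hs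
    simp only [greenG, min_eq_left hs.1, max_eq_right hs.1, min_eq_left (hxy.trans hs.1),
      max_eq_right (hxy.trans hs.1), smul_eq_mul]
    ring
  rw [integral_muMeas, ← intervalIntegral.integral_add_adjacent_intervals
    (hc.intervalIntegrable 0 y) (hc.intervalIntegrable y 1),
    ← intervalIntegral.integral_add_adjacent_intervals
    (hc.intervalIntegrable 0 x) (hc.intervalIntegrable x y), i1, i2, i3]
  simp only [greenG, min_eq_left hxy, max_eq_right hxy]
  linear_combination regB ν k x * regB ν l y * e1 + regA ν k x * regB ν l y * e2 +
    regA ν k x * regA ν l y * e3 + regA ν l x * regB ν l y * wronskian_reg h1 hk x -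
    regA ν k x * regB ν k y * wronskian_reg h1 hl y

end Green

lemma sinh_le_mul_cosh {z : ℝ} (hz : 0 ≤ z) : sinh z ≤ z * cosh z := by
  have h : MonotoneOn (fun z => z * cosh z - sinh z) (Ici 0) := by
    refine monotoneOn_of_hasDerivWithinAt_nonneg (convex_Ici 0) (by fun_prop)
      (f' := fun z => z * sinh z) (fun x _ => ?_) (fun x hx => ?_)
    · refine HasDerivAt.hasDerivWithinAt ?_
      refine (((hasDerivAt_id x).mul (Real.hasDerivAt_cosh x)).sub
        (Real.hasDerivAt_sinh x)).congr_deriv ?_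
      simp
    · rw [interior_Ici] at hx
      exact mul_nonneg (le_of_lt hx) (Real.sinh_nonneg_iff.2 (le_of_lt hx))
  have := h (mem_Ici.2 le_rfl) hz hz
  simpa using this

section Growth
variable {ν : ℝ}

/-- The exponential growth rate used for the regular solutions. -/
noncomputable def growthC (ν : ℝ) : ℝ := (√(2 * ν + 2))⁻¹

lemma growthC_pos (hν : -1 < ν) : 0 < growthC ν :=
  inv_pos.2 (Real.sqrt_pos.2 (by linarith))

lemma growthC_sq (hν : -1 < ν) : growthC ν ^ 2 * (2 * ν + 2) = 1 := by
  unfold growthC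
  rw [inv_pow, Real.sq_sqrt (by linarith), inv_mul_cancel₀ (by linarith)]

lemma regQ_mul_cosh_ge (hν : -(1 / 2 : ℝ) < ν) {u : ℝ} (hu : 0 ≤ u) {x : ℝ} (hx : 0 ≤ x) :
    0 ≤ regQ ν (u ^ 2) x * cosh (growthC ν * u * x) -
      regA ν (u ^ 2) x * (x ^ (2 * ν + 1) * (growthC ν * u * sinh (growthC ν * u * x))) := by
  have h1 : -1 < ν := by linarith
  set c := growthC ν with hcdef
  have hc : 0 < c := growthC_pos h1
  have hc2 : c ^ 2 * (2 * ν + 2) = 1 := growthC_sq h1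
  have h : MonotoneOn (fun x => regQ ν (u ^ 2) x * cosh (c * u * x) -
      regA ν (u ^ 2) x * (x ^ (2 * ν + 1) * (c * u * sinh (c * u * x)))) (Ici 0) := by
    refine monotoneOn_of_hasDerivWithinAt_nonneg (convex_Ici 0) (f' := fun x =>
      regA ν (u ^ 2) x * (x ^ (2 * ν + 1) * u ^ 2 * cosh (c * u * x) -
        ((2 * ν + 1) * x ^ (2 * ν) * (c * u * sinh (c * u * x)) +
          x ^ (2 * ν + 1) * (c ^ 2 * u ^ 2 * cosh (c * u * x))))) ?_ ?_ ?_
    · refine Continuous.continuousOn ?_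
      have := continuous_regA (𝕜 := ℝ) h1 (u ^ 2)
      have := continuous_regQ (𝕜 := ℝ) h1 (u ^ 2)
      have := continuous_weight hν
      fun_prop
    · intro x hx
      rw [interior_Ici] at hx
      have hx' : 0 < x := hx
      obtain ⟨hA, hQ⟩ := isBesselSol_reg (𝕜 := ℝ) h1 (u ^ 2) hx'
      have hl : HasDerivAt (fun x => c * u * x) (c * u) x := by
        simpa using (hasDerivAt_id x).const_mul (c * u)
      have hp := Real.hasDerivAt_rpow_const (x := x) (p := 2 * ν + 1) (Or.inl hx'.ne')
      refine HasDerivAt.hasDerivWithinAt ?_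
      refine ((hQ.mul hl.cosh).sub (hA.mul (hp.mul (hl.sinh.const_mul (c * u))))).congr_deriv ?_
      have hpp := (Real.rpow_pos_of_pos hx' (2 * ν + 1)).ne'
      rw [show 2 * ν + 1 - 1 = 2 * ν by ring]
      simp only [smul_eq_mul, Pi.mul_apply]
      field_simp
      ring
    · intro x hx
      rw [interior_Ici] at hx
      have hx' : 0 < x := hx
      refine mul_nonneg (regA_pos h1 (sq_nonneg u) x).le ?_
      rw [Real.rpow_add_one hx'.ne']
      have hp := Real.rpow_pos_of_pos hx' (2 * ν)
      have hs := sinh_le_mul_cosh (show 0 ≤ c * u * x by positivity)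
      have : (2 * ν + 1) * (c * u * sinh (c * u * x)) ≤
          (2 * ν + 1) * (c * u * (c * u * x * cosh (c * u * x))) := by
        have : 0 < 2 * ν + 1 := by linarith
        gcongr
      have e : x * u ^ 2 * cosh (c * u * x) - x * (c ^ 2 * u ^ 2 * cosh (c * u * x)) -
          (2 * ν + 1) * (c * u * (c * u * x * cosh (c * u * x))) = 0 := by
        linear_combination (-x * u ^ 2 * cosh (c * u * x)) * hc2
      have : 0 ≤ x * u ^ 2 * cosh (c * u * x) - ((2 * ν + 1) * (c * u * sinh (c * u * x)) +
        x * (c ^ 2 * u ^ 2 * cosh (c * u * x))) := by linarith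
      have := mul_nonneg hp.le this
      linarith
  have h2 := h (mem_Ici.2 le_rfl) hx hx
  simpa [regQ_zero h1, Real.zero_rpow (show 2 * ν + 1 ≠ 0 by linarith)] using h2

lemma monotoneOn_regA_div_cosh (hν : -(1 / 2 : ℝ) < ν) {u : ℝ} (hu : 0 ≤ u) :
    MonotoneOn (fun x => regA ν (u ^ 2) x / cosh (growthC ν * u * x)) (Ici 0) := by
  have h1 : -1 < ν := by linarith
  refine monotoneOn_of_hasDerivWithinAt_nonneg (convex_Ici 0) (f' := fun x =>
    (regQ ν (u ^ 2) x * cosh (growthC ν * u * x) -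
      regA ν (u ^ 2) x * (x ^ (2 * ν + 1) * (growthC ν * u * sinh (growthC ν * u * x)))) /
      (x ^ (2 * ν + 1) * cosh (growthC ν * u * x) ^ 2)) ?_ ?_ ?_
  · refine ((continuous_regA h1 _).div (by fun_prop) fun x => ?_).continuousOn
    exact (Real.cosh_pos _).ne'
  · intro x hx
    rw [interior_Ici] at hx
    have hx' : 0 < x := hx
    obtain ⟨hA, -⟩ := isBesselSol_reg (𝕜 := ℝ) h1 (u ^ 2) hx'
    have hl : HasDerivAt (fun x => growthC ν * u * x) (growthC ν * u) x := by
      simpa using (hasDerivAt_id x).const_mul (growthC ν * u)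
    have hch := (Real.cosh_pos (growthC ν * u * x)).ne'
    refine HasDerivAt.hasDerivWithinAt ?_
    refine (hA.div hl.cosh hch).congr_deriv ?_
    have hpp := (Real.rpow_pos_of_pos hx' (2 * ν + 1)).ne'
    simp only [smul_eq_mul]
    field_simp
  · intro x hx
    rw [interior_Ici] at hx
    have hx' : 0 < x := hx
    have := Real.rpow_pos_of_pos hx' (2 * ν + 1)
    exact div_nonneg (regQ_mul_cosh_ge hν hu hx'.le) (by positivity)

lemma regA_le_exp_mul (hν : -(1 / 2 : ℝ) < ν) {u : ℝ} (hu : 0 ≤ u) {x s : ℝ} (hx : 0 ≤ x)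
    (hxs : x ≤ s) :
    regA ν (u ^ 2) x ≤ 2 * exp (-(growthC ν * u * (s - x))) * regA ν (u ^ 2) s := by
  have h1 : -1 < ν := by linarith
  have hm := monotoneOn_regA_div_cosh hν hu hx (hx.trans hxs) hxs
  have hA := regA_pos h1 (sq_nonneg u) s
  have hc := growthC_pos h1
  simp only at hm
  rw [div_le_div_iff₀ (Real.cosh_pos _) (Real.cosh_pos _)] at hm
  have e1 : cosh (growthC ν * u * x) ≤ exp (growthC ν * u * x) := by
    rw [Real.cosh_eq]
    have : exp (-(growthC ν * u * x)) ≤ exp (growthC ν * u * x) := by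
      refine Real.exp_le_exp.2 ?_
      have : 0 ≤ growthC ν * u * x := by positivity
      linarith
    linarith
  have e2 : exp (growthC ν * u * s) ≤ 2 * cosh (growthC ν * u * s) := by
    rw [Real.cosh_eq]
    have := Real.exp_pos (-(growthC ν * u * s))
    linarith
  have e3 : exp (-(growthC ν * u * (s - x))) * exp (growthC ν * u * s) =
      exp (growthC ν * u * x) := by
    rw [← Real.exp_add]; ring_nf
  have hE := Real.exp_pos (growthC ν * u * s)
  have hAx := regA_pos h1 (sq_nonneg u) x
  refine le_of_mul_le_mul_right ?_ hE
  calc regA ν (u ^ 2) x * exp (growthC ν * u * s)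
      ≤ regA ν (u ^ 2) x * (2 * cosh (growthC ν * u * s)) := by gcongr
    _ = 2 * (regA ν (u ^ 2) x * cosh (growthC ν * u * s)) := by ring
    _ ≤ 2 * (regA ν (u ^ 2) s * cosh (growthC ν * u * x)) := by gcongr
    _ ≤ 2 * (regA ν (u ^ 2) s * exp (growthC ν * u * x)) := by gcongr
    _ = _ := by rw [← e3]; ring

lemma regA_le_regA (hν : -(1 / 2 : ℝ) < ν) {u : ℝ} (hu : 0 ≤ u) {x s : ℝ} (hx : 0 ≤ x)
    (hxs : x ≤ s) : regA ν (u ^ 2) x ≤ regA ν (u ^ 2) s := by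
  have h1 : -1 < ν := by linarith
  have hm := monotoneOn_regA_div_cosh hν hu hx (hx.trans hxs) hxs
  have hA := regA_pos h1 (sq_nonneg u) s
  have hc := growthC_pos h1
  simp only at hm
  rw [div_le_div_iff₀ (Real.cosh_pos _) (Real.cosh_pos _)] at hm
  have : cosh (growthC ν * u * x) ≤ cosh (growthC ν * u * s) := by
    rw [Real.cosh_le_cosh, abs_of_nonneg (by positivity),
      abs_of_nonneg (mul_nonneg (by positivity) (hx.trans hxs))]
    gcongr
  refine le_of_mul_le_mul_right (hm.trans ?_) (Real.cosh_pos (growthC ν * u * s))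
  gcongr

lemma greenG_nonneg (hν : -1 < ν) {k : ℝ} (hk : 0 ≤ k) {x y : ℝ} (hx : 0 < x) (hx1 : x ≤ 1)
    (hy1 : y ≤ 1) : 0 ≤ greenG ν k x y :=
  mul_nonneg (regA_pos hν hk _).le (mul_nonneg (regA_pos hν hk _).le
    (regD_nonneg (hx.trans_le (le_max_left _ _)) (max_le hx1 hy1)))

lemma greenG_le (hν : -(1 / 2 : ℝ) < ν) {u : ℝ} (hu : 0 ≤ u) {x y : ℝ} (hx : 0 < x)
    (hxy : x ≤ y) (hy : y ≤ 1) :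
    greenG ν (u ^ 2) x y ≤
      2 * exp (-(growthC ν * u * (y - x))) * ((1 - y) * (y ^ (2 * ν + 1))⁻¹) := by
  have h1 : -1 < ν := by linarith
  have hy0 : 0 < y := hx.trans_le hxy
  have hp := Real.rpow_pos_of_pos hy0 (2 * ν + 1)
  have hA := regA_pos h1 (sq_nonneg u)
  have hD : regD ν (u ^ 2) y ≤ (1 - y) * ((y ^ (2 * ν + 1)) * regA ν (u ^ 2) y ^ 2)⁻¹ := by
    calc regD ν (u ^ 2) y ≤ ∫ _ in y..1, ((y ^ (2 * ν + 1)) * regA ν (u ^ 2) y ^ 2)⁻¹ := by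
          refine intervalIntegral.integral_mono_on hy
            (intervalIntegrable_regD h1 (sq_nonneg u) hy0 one_pos) (by simp) fun s hs => ?_
          have := hA y
          have := regA_le_regA hν hu hy0.le hs.1
          have := Real.rpow_le_rpow hy0.le hs.1 (show 0 ≤ 2 * ν + 1 by linarith)
          have := hp.le.trans this
          gcongr
      _ = _ := by rw [intervalIntegral.integral_const, smul_eq_mul]
  simp only [greenG, min_eq_left hxy, max_eq_right hxy, regB]
  have := hA y
  have hy' : 0 ≤ 1 - y := by linarith
  calc _ ≤ (2 * exp (-(growthC ν * u * (y - x))) * regA ν (u ^ 2) y) *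
        (regA ν (u ^ 2) y * ((1 - y) * ((y ^ (2 * ν + 1)) * regA ν (u ^ 2) y ^ 2)⁻¹)) := by
        have := regA_le_exp_mul hν hu hx.le hxy
        have := regD_nonneg (ν := ν) (k := u ^ 2) hy0 hy
        gcongr
    _ = _ := by field_simp

end Growth

section Expansion
variable {ν : ℝ} {Λ : ℕ → ℝ}

lemma integral_greenG_mul_eigE (hν : -(1 / 2 : ℝ) < ν) (hΛ : IsPositiveZerosOfBesselJ ν Λ)
    (n : ℕ) (u : ℝ) {x : ℝ} (hx : x ∈ Ioo (0 : ℝ) 1) :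
    ∫ s, greenG ν (u ^ 2) x s * eigE ν Λ n s ∂(muMeas ν) =
      eigE ν Λ n x / (u ^ 2 + Λ n ^ 2) := by
  have h := integral_greenG_mul_regA hν (sq_nonneg u) hx (bes_neg_sq_eq_zero hΛ n)
  have hL := hΛ.2.1 n
  have hpos : 0 < u ^ 2 + Λ n ^ 2 := by positivity
  have e : ∀ s, greenG ν (u ^ 2) x s * eigE ν Λ n s =
      (greenG ν (u ^ 2) x s * regA ν (-(Λ n) ^ 2) s) / √(eigN ν (-(Λ n) ^ 2)) := fun s => by
    rw [eigE, mul_div_assoc]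
  simp_rw [e]
  rw [integral_div, eigE, ← h, sub_neg_eq_add]
  field_simp

lemma hasSum_eigE_div (hν : -(1 / 2 : ℝ) < ν) (hΛ : IsPositiveZerosOfBesselJ ν Λ) (u v : ℝ)
    {x y : ℝ} (hx : 0 < x) (hxy : x ≤ y) (hy : y < 1) :
    HasSum (fun n => eigE ν Λ n x * eigE ν Λ n y / (u ^ 2 + Λ n ^ 2) *
      ((v ^ 2 - u ^ 2) / (v ^ 2 + Λ n ^ 2)))
      (greenG ν (u ^ 2) x y - greenG ν (v ^ 2) x y) := by
  have h1 : -1 < ν := by linarith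
  have hm := fun (u : ℝ) {x : ℝ} (hx : 0 < x) => memLp_muMeas hν
    (continuous_greenG h1 (sq_nonneg u) hx).continuousOn 2
  have h := hasSum_parseval hν hΛ (hm u hx) (hm v (hx.trans_le hxy))
  simp_rw [integral_greenG_mul_eigE hν hΛ _ u ⟨hx, hxy.trans_lt hy⟩,
    integral_greenG_mul_eigE hν hΛ _ v ⟨hx.trans_le hxy, hy⟩] at h
  have h2 := integral_greenG_mul_greenG hν (sq_nonneg u) (sq_nonneg v) hx hxy hy
  have h3 := h.mul_left (v ^ 2 - u ^ 2)
  have e1 : (fun n => eigE ν Λ n x * eigE ν Λ n y / (u ^ 2 + Λ n ^ 2) *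
      ((v ^ 2 - u ^ 2) / (v ^ 2 + Λ n ^ 2))) = fun n => (v ^ 2 - u ^ 2) *
      (eigE ν Λ n x / (u ^ 2 + Λ n ^ 2) * (eigE ν Λ n y / (v ^ 2 + Λ n ^ 2))) :=
    funext fun n => by
      have hL := hΛ.2.1 n
      field_simp
  have e2 : greenG ν (u ^ 2) x y - greenG ν (v ^ 2) x y = (v ^ 2 - u ^ 2) *
      ∫ s, greenG ν (u ^ 2) x s * greenG ν (v ^ 2) y s ∂(muMeas ν) := by
    linear_combination h2
  rw [e1, e2]
  exact h3

lemma tendsto_sq_div (a b : ℝ) (hb : 0 < b) :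
    Tendsto (fun N : ℕ => ((N : ℝ) ^ 2 - a) / ((N : ℝ) ^ 2 + b)) atTop (𝓝 1) := by
  have h : Tendsto (fun N : ℕ => (a + b) / ((N : ℝ) ^ 2 + b)) atTop (𝓝 0) :=
    Tendsto.div_atTop tendsto_const_nhds (tendsto_atTop_add_const_right _ _
      ((tendsto_pow_atTop two_ne_zero).comp tendsto_natCast_atTop_atTop))
  have h2 := h.const_sub 1
  rw [sub_zero] at h2
  refine h2.congr fun N => ?_
  have : (N : ℝ) ^ 2 + b ≠ 0 := by positivity
  field_simp
  ring

lemma summable_eigE_sq_div (hν : -(1 / 2 : ℝ) < ν) (hΛ : IsPositiveZerosOfBesselJ ν Λ)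
    {x : ℝ} (hx : x ∈ Ioo (0 : ℝ) 1) : Summable fun n => eigE ν Λ n x ^ 2 / Λ n ^ 2 := by
  have h1 : -1 < ν := by linarith
  refine summable_of_sum_le (c := greenG ν (0 ^ 2) x x) (fun n => by positivity) fun s => ?_
  have hlim : Tendsto (fun N : ℕ => ∑ n ∈ s, eigE ν Λ n x * eigE ν Λ n x / (0 ^ 2 + Λ n ^ 2) *
      (((N : ℝ) ^ 2 - 0 ^ 2) / ((N : ℝ) ^ 2 + Λ n ^ 2))) atTop
      (𝓝 (∑ n ∈ s, eigE ν Λ n x * eigE ν Λ n x / (0 ^ 2 + Λ n ^ 2) * 1)) :=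
    tendsto_finsetSum _ fun n _ => (tendsto_sq_div _ _ (by
      have := hΛ.2.1 n
      positivity)).const_mul _
  have e : ∑ n ∈ s, eigE ν Λ n x ^ 2 / Λ n ^ 2 =
      ∑ n ∈ s, eigE ν Λ n x * eigE ν Λ n x / (0 ^ 2 + Λ n ^ 2) * 1 :=
    Finset.sum_congr rfl fun n _ => by ring_nf
  rw [e]
  refine le_of_tendsto' hlim fun N => ?_
  have h := hasSum_eigE_div hν hΛ 0 N hx.1 le_rfl hx.2
  refine (sum_le_hasSum s (fun n _ => ?_) h).trans ?_
  · rw [← pow_two, zero_pow two_ne_zero, sub_zero]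
    positivity
  · have := greenG_nonneg h1 (sq_nonneg (N : ℝ)) hx.1 hx.2.le hx.2.le
    linarith

lemma summable_abs_eigE_mul_div (hν : -(1 / 2 : ℝ) < ν) (hΛ : IsPositiveZerosOfBesselJ ν Λ)
    {x y : ℝ} (hx : x ∈ Ioo (0 : ℝ) 1) (hy : y ∈ Ioo (0 : ℝ) 1) :
    Summable fun n => |eigE ν Λ n x * eigE ν Λ n y| / Λ n ^ 2 := by
  refine Summable.of_nonneg_of_le (fun n => by positivity) (fun n => ?_)
    ((summable_eigE_sq_div hν hΛ hx).add (summable_eigE_sq_div hν hΛ hy))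
  rw [← add_div]
  gcongr
  rw [abs_mul]
  nlinarith [sq_abs (eigE ν Λ n x), sq_abs (eigE ν Λ n y), sq_nonneg (eigE ν Λ n x),
    sq_nonneg (eigE ν Λ n y), sq_nonneg (|eigE ν Λ n x| - |eigE ν Λ n y|)]

lemma tendsto_greenG (hν : -(1 / 2 : ℝ) < ν) {x y : ℝ} (hx : 0 < x) (hxy : x < y) (hy : y < 1) :
    Tendsto (fun N : ℕ => greenG ν ((N : ℝ) ^ 2) x y) atTop (𝓝 0) := by
  have h1 : -1 < ν := by linarith
  have hc := growthC_pos h1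
  have h : Tendsto (fun N : ℕ => 2 * exp (-(growthC ν * N * (y - x))) *
      ((1 - y) * (y ^ (2 * ν + 1))⁻¹)) atTop (𝓝 (2 * 0 * ((1 - y) * (y ^ (2 * ν + 1))⁻¹))) := by
    refine (Tendsto.const_mul 2 ?_).mul_const _
    refine Real.tendsto_exp_neg_atTop_nhds_zero.comp ?_
    refine Tendsto.atTop_mul_const (sub_pos.2 hxy) ?_
    exact tendsto_natCast_atTop_atTop.const_mul_atTop hc
  rw [mul_zero, zero_mul] at h
  exact squeeze_zero (fun N => greenG_nonneg h1 (sq_nonneg _) hx (hxy.trans hy).le hy.le)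
    (fun N => greenG_le hν (Nat.cast_nonneg N) hx hxy.le hy.le) h

lemma hasSum_greenG (hν : -(1 / 2 : ℝ) < ν) (hΛ : IsPositiveZerosOfBesselJ ν Λ) (u : ℝ)
    {x y : ℝ} (hx : 0 < x) (hxy : x < y) (hy : y < 1) :
    HasSum (fun n => eigE ν Λ n x * eigE ν Λ n y / (u ^ 2 + Λ n ^ 2))
      (greenG ν (u ^ 2) x y) := by
  have hs := summable_abs_eigE_mul_div hν hΛ ⟨hx, hxy.trans hy⟩ ⟨hx.trans hxy, hy⟩
  have hle : ∀ n, ‖eigE ν Λ n x * eigE ν Λ n y / (u ^ 2 + Λ n ^ 2)‖ ≤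
      |eigE ν Λ n x * eigE ν Λ n y| / Λ n ^ 2 := fun n => by
    have hL := hΛ.2.1 n
    rw [norm_div, Real.norm_eq_abs, Real.norm_of_nonneg (by positivity)]
    gcongr
    exact le_add_of_nonneg_left (sq_nonneg u)
  have hsum : Summable fun n => eigE ν Λ n x * eigE ν Λ n y / (u ^ 2 + Λ n ^ 2) :=
    Summable.of_norm_bounded hs hle
  have ht := tendsto_tsum_of_dominated_convergence (𝓕 := (atTop : Filter ℕ))
    (f := fun (N : ℕ) n => eigE ν Λ n x * eigE ν Λ n y / (u ^ 2 + Λ n ^ 2) *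
      (((N : ℝ) ^ 2 - u ^ 2) / ((N : ℝ) ^ 2 + Λ n ^ 2)))
    (g := fun n => eigE ν Λ n x * eigE ν Λ n y / (u ^ 2 + Λ n ^ 2) * 1) hs
    (fun n => (tendsto_sq_div _ _ (by have := hΛ.2.1 n; positivity)).const_mul _) (by
      filter_upwards [eventually_ge_atTop ⌈|u|⌉₊] with N hN n
      have hL := hΛ.2.1 n
      have hNu : u ^ 2 ≤ (N : ℝ) ^ 2 := by
        rw [← sq_abs u]
        gcongr
        exact Nat.ceil_le.1 hN
      rw [norm_mul]
      refine (mul_le_of_le_one_right (norm_nonneg _) ?_).trans (hle n)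
      rw [Real.norm_of_nonneg (div_nonneg (by linarith) (by positivity))]
      refine div_le_one_of_le₀ ?_ (by positivity)
      nlinarith)
  simp_rw [mul_one, fun N : ℕ => (hasSum_eigE_div hν hΛ u N hx hxy.le hy).tsum_eq] at ht
  have h2 := (tendsto_greenG hν hx hxy hy).const_sub (greenG ν (u ^ 2) x y)
  rw [sub_zero] at h2
  rw [← tendsto_nhds_unique ht h2]
  exact hsum.hasSum

end Expansion

section CosineIntegral

lemma integrable_inv_sq_add_sq {L : ℝ} (hL : 0 < L) :
    Integrable fun u : ℝ => (u ^ 2 + L ^ 2)⁻¹ := by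
  have h := (integrable_inv_one_add_sq.comp_div hL.ne').const_mul ((L ^ 2)⁻¹)
  refine h.congr (Eventually.of_forall fun u => ?_)
  show (L ^ 2)⁻¹ * (1 + (u / L) ^ 2)⁻¹ = (u ^ 2 + L ^ 2)⁻¹
  field_simp
  ring

lemma integrable_cos_mul_inv {L : ℝ} (hL : 0 < L) (t : ℝ) :
    Integrable fun u : ℝ => cos (t * u) * (u ^ 2 + L ^ 2)⁻¹ := by
  refine (integrable_inv_sq_add_sq hL).bdd_mul (c := 1) (by fun_prop) ?_
  exact Eventually.of_forall fun u => by simpa using abs_cos_le_one (t * u)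

lemma integrable_exp_neg_mul_abs_complex {a : ℝ} (ha : 0 < a) (b : ℝ) :
    IntegrableOn (fun s : ℝ => Complex.exp ((b * s : ℝ) * Complex.I) * Complex.exp (-(a * |s| : ℝ)))
      (Iic 0) ∧
    IntegrableOn (fun s : ℝ => Complex.exp ((b * s : ℝ) * Complex.I) * Complex.exp (-(a * |s| : ℝ)))
      (Ioi 0) ∧
    ∫ s : ℝ, Complex.exp ((b * s : ℝ) * Complex.I) * Complex.exp (-(a * |s| : ℝ)) =
      (2 * a / (a ^ 2 + b ^ 2) : ℝ) := by
  have e1 : EqOn (fun s : ℝ => Complex.exp ((a + b * Complex.I) * s))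
      (fun s : ℝ => Complex.exp ((b * s : ℝ) * Complex.I) * Complex.exp (-(a * |s| : ℝ)))
      (Iic 0) := fun s hs => by
    show Complex.exp _ = _ * _
    rw [abs_of_nonpos hs, ← Complex.exp_add]
    congr 1
    push_cast
    ring
  have e2 : EqOn (fun s : ℝ => Complex.exp ((-a + b * Complex.I) * s))
      (fun s : ℝ => Complex.exp ((b * s : ℝ) * Complex.I) * Complex.exp (-(a * |s| : ℝ)))
      (Ioi 0) := fun s hs => by
    show Complex.exp _ = _ * _
    rw [abs_of_pos hs, ← Complex.exp_add]
    congr 1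
    push_cast
    ring
  have r1 : 0 < ((a : ℂ) + b * Complex.I).re := by simpa
  have r2 : (-(a : ℂ) + b * Complex.I).re < 0 := by simpa
  have i1 := (integrableOn_exp_mul_complex_Iic r1 0).congr_fun e1 measurableSet_Iic
  have i2 := (integrableOn_exp_mul_complex_Ioi r2 0).congr_fun e2 measurableSet_Ioi
  refine ⟨i1, i2, ?_⟩
  rw [← intervalIntegral.integral_Iic_add_Ioi i1 i2, ← setIntegral_congr_fun measurableSet_Iic e1,
    ← setIntegral_congr_fun measurableSet_Ioi e2, integral_exp_mul_complex_Iic r1,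
    integral_exp_mul_complex_Ioi r2]
  have n1 : (a : ℂ) + b * Complex.I ≠ 0 := fun h => by rw [h] at r1; simp at r1
  have n2 : -(a : ℂ) + b * Complex.I ≠ 0 := fun h => by rw [h] at r2; simp at r2
  have n3 : ((a : ℂ) ^ 2 + b ^ 2) ≠ 0 := by
    norm_cast
    positivity
  push_cast
  rw [mul_zero, mul_zero, Complex.exp_zero]
  field_simp
  linear_combination (-2 * a * b ^ 2 : ℂ) * Complex.I_sq

lemma integral_cos_mul_inv {L t : ℝ} (hL : 0 < L) (ht : 0 < t) :
    ∫ u in Ioi (0 : ℝ), cos (t * u) * (u ^ 2 + L ^ 2)⁻¹ = π / 2 * (exp (-t * L) / L) := by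
  have hpi := Real.pi_pos
  set a := 2 * π * L with ha
  have ha0 : 0 < a := by positivity
  let f : ℝ → ℂ := fun s => Complex.exp (-(a * |s| : ℝ))
  have hfc : Continuous f := by fun_prop
  have hfi : Integrable f := by
    obtain ⟨i1, i2, -⟩ := integrable_exp_neg_mul_abs_complex ha0 0
    have := i1.union i2
    rw [Iic_union_Ioi, integrableOn_univ] at this
    simpa [f] using this
  have hF : FourierTransform.fourier f = fun ξ : ℝ => ((L / π * (ξ ^ 2 + L ^ 2)⁻¹ : ℝ) : ℂ) := by
    ext ξ
    rw [Real.fourier_real_eq_integral_exp_smul]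
    have h := (integrable_exp_neg_mul_abs_complex ha0 (-2 * π * ξ)).2.2
    have e : ∀ v : ℝ, Complex.exp (((-2 * π * v * ξ : ℝ) : ℂ) * Complex.I) • f v =
        Complex.exp ((-2 * π * ξ * v : ℝ) * Complex.I) * Complex.exp (-(a * |v| : ℝ)) := fun v => by
      rw [smul_eq_mul, show -2 * π * v * ξ = -2 * π * ξ * v by ring]
    simp_rw [e, h, ha]
    congr 1
    have : ξ ^ 2 + L ^ 2 ≠ 0 := by positivity
    have : (2 * π * L) ^ 2 + (-2 * π * ξ) ^ 2 ≠ 0 := by positivity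
    field_simp
    ring
  have hFi : Integrable (FourierTransform.fourier f) := by
    rw [hF]
    exact ((integrable_inv_sq_add_sq hL).const_mul (L / π)).ofReal
  have hinv := congrFun (hfc.fourierInv_fourier_eq hfi hFi) (t / (2 * π))
  rw [Real.fourierInv_eq', hF] at hinv
  have e : ∀ v : ℝ, RCLike.re
      (Complex.exp (((2 * π * inner ℝ v (t / (2 * π)) : ℝ) : ℂ) * Complex.I) •
      ((L / π * (v ^ 2 + L ^ 2)⁻¹ : ℝ) : ℂ)) = L / π * (cos (t * v) * (v ^ 2 + L ^ 2)⁻¹) := fun v => by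
    rw [smul_eq_mul, RCLike.re_eq_complex_re, Complex.re_mul_ofReal, Complex.exp_ofReal_mul_I_re,
      show 2 * π * inner ℝ v (t / (2 * π)) = t * v by
        rw [RCLike.inner_apply, conj_trivial]
        field_simp]
    ring
  have hintegrable : Integrable fun v : ℝ =>
      Complex.exp (((2 * π * inner ℝ v (t / (2 * π)) : ℝ) : ℂ) * Complex.I) •
      ((L / π * (v ^ 2 + L ^ 2)⁻¹ : ℝ) : ℂ) := by
    rw [hF] at hFi
    refine hFi.bdd_mul (c := 1) (by fun_prop) (Eventually.of_forall fun v => ?_)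
    rw [Complex.norm_exp_ofReal_mul_I]
  have hre := congrArg RCLike.re hinv
  rw [← integral_re hintegrable] at hre
  simp_rw [e] at hre
  rw [integral_const_mul] at hre
  have habs := integral_comp_abs (f := fun v : ℝ => cos (t * v) * (v ^ 2 + L ^ 2)⁻¹)
  have e3 : ∀ v : ℝ, cos (t * |v|) * (|v| ^ 2 + L ^ 2)⁻¹ = cos (t * v) * (v ^ 2 + L ^ 2)⁻¹ := fun v => by
    rw [sq_abs, ← abs_of_pos ht, ← abs_mul, cos_abs, abs_of_pos ht]
  simp_rw [e3] at habs
  rw [habs] at hre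
  have hfr : RCLike.re (f (t / (2 * π))) = exp (-t * L) := by
    show (Complex.exp _).re = _
    rw [← Complex.ofReal_neg, Complex.exp_ofReal_re, abs_of_pos (by positivity), ha]
    congr 1
    field_simp
  rw [hfr] at hre
  rw [← hre]
  field_simp

lemma abs_integral_cos_mul_inv_le {L t R : ℝ} (hL : 0 < L) (ht : 0 < t) (hR : 0 ≤ R) :
    |∫ u in (0 : ℝ)..R, cos (t * u) * (u ^ 2 + L ^ 2)⁻¹| ≤ (t * L ^ 2)⁻¹ := by
  have hp : ∀ u : ℝ, 0 < u ^ 2 + L ^ 2 := fun u => by positivity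
  have hd : ∀ u : ℝ, HasDerivAt (fun u : ℝ => (u ^ 2 + L ^ 2)⁻¹) (-(2 * u) / (u ^ 2 + L ^ 2) ^ 2) u :=
    fun u => by
      have := ((hasDerivAt_pow 2 u).add_const (L ^ 2)).fun_inv (hp u).ne'
      simpa using this
  have hs : ∀ u : ℝ, HasDerivAt (fun u : ℝ => sin (t * u) / t) (cos (t * u)) u := fun u => by
    have := (((hasDerivAt_id u).const_mul t).sin).div_const t
    simp only [id, mul_one] at this
    rwa [mul_div_cancel_right₀ _ ht.ne'] at this
  have hcd : Continuous fun u : ℝ => -(2 * u) / (u ^ 2 + L ^ 2) ^ 2 :=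
    Continuous.div (by fun_prop) (by fun_prop) fun u => by have := hp u; positivity
  have hib := intervalIntegral.integral_mul_deriv_eq_deriv_mul (a := 0) (b := R)
    (fun u _ => hd u) (fun u _ => hs u) (hcd.intervalIntegrable _ _)
    ((by fun_prop : Continuous fun u : ℝ => cos (t * u)).intervalIntegrable _ _)
  have hfd := intervalIntegral.integral_eq_sub_of_hasDerivAt (a := 0) (b := R) (fun u _ => hd u)
    (hcd.intervalIntegrable _ _)
  simp_rw [mul_comm (cos _)]
  rw [hib]
  have hbd : |∫ u in (0 : ℝ)..R, -(2 * u) / (u ^ 2 + L ^ 2) ^ 2 * (sin (t * u) / t)| ≤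
      ∫ u in (0 : ℝ)..R, -(-(2 * u) / (u ^ 2 + L ^ 2) ^ 2) * (1 / t) := by
    refine (intervalIntegral.abs_integral_le_integral_abs hR).trans ?_
    refine intervalIntegral.integral_mono_on hR
      (Continuous.intervalIntegrable (by fun_prop) _ _)
      (Continuous.intervalIntegrable (by fun_prop) _ _) fun u hu => ?_
    have h1 : -(2 * u) / (u ^ 2 + L ^ 2) ^ 2 ≤ 0 :=
      div_nonpos_of_nonpos_of_nonneg (by linarith [hu.1]) (by positivity)
    rw [abs_mul, abs_of_nonpos h1, abs_div, abs_of_pos ht]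
    gcongr
    · linarith
    · exact abs_sin_le_one _
  rw [intervalIntegral.integral_mul_const, intervalIntegral.integral_neg, hfd] at hbd
  have h2 : |(R ^ 2 + L ^ 2)⁻¹ * (sin (t * R) / t)| ≤ (R ^ 2 + L ^ 2)⁻¹ * (1 / t) := by
    rw [abs_mul, abs_of_pos (inv_pos.2 (hp R)), abs_div, abs_of_pos ht]
    have := (hp R)
    gcongr
    exact abs_sin_le_one _
  have h3 : (t * L ^ 2)⁻¹ = (0 ^ 2 + L ^ 2)⁻¹ * (1 / t) := by
    field_simp
    ring
  rw [mul_zero, sin_zero, zero_div, mul_zero, sub_zero, h3]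
  refine (abs_sub _ _).trans ?_
  linarith

end CosineIntegral

section KernelBound
variable {ν : ℝ} {Λ : ℕ → ℝ}

lemma pKer_eq_tsum (hν : -(1 / 2 : ℝ) < ν) (hΛ : IsPositiveZerosOfBesselJ ν Λ) (t : ℝ)
    {x y : ℝ} (hx : 0 < x) (hy : 0 < y) :
    pKer ν Λ t x y = ∑' n, eigE ν Λ n x * eigE ν Λ n y * (exp (-t * Λ n) / Λ n) := by
  refine tsum_congr fun n => ?_
  have hN := eigN_pos hν (-(Λ n) ^ 2)
  rw [mul_assoc, phiFB_mul_phiFB hν hΛ n hx hy, eigE, eigE, div_mul_div_comm,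
    Real.mul_self_sqrt hN.le]
  ring

lemma pKer_comm (t x y : ℝ) : pKer ν Λ t x y = pKer ν Λ t y x :=
  tsum_congr fun n => by ring

lemma integral_exp_neg_mul_le {k R : ℝ} (hk : 0 < k) :
    ∫ u in (0 : ℝ)..R, exp (-(k * u)) ≤ k⁻¹ := by
  have hd : ∀ u : ℝ, HasDerivAt (fun u : ℝ => -(exp (-(k * u)) / k)) (exp (-(k * u))) u := fun u => by
    have := ((((hasDerivAt_id u).const_mul k).fun_neg.exp).div_const k).fun_neg
    simp only [id, mul_one] at this
    rwa [mul_neg, neg_div, neg_neg, mul_div_cancel_right₀ _ hk.ne'] at this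
  rw [intervalIntegral.integral_eq_sub_of_hasDerivAt (fun u _ => hd u)
    ((by fun_prop : Continuous fun u : ℝ => exp (-(k * u))).intervalIntegrable _ _)]
  have : 0 < exp (-(k * R)) / k := by positivity
  simp only [mul_zero, neg_zero, exp_zero, one_div]
  linarith

lemma abs_pKer_le_of_lt (hν : -(1 / 2 : ℝ) < ν) (hΛ : IsPositiveZerosOfBesselJ ν Λ) {t : ℝ}
    (ht : 0 < t) {x y : ℝ} (hx : 0 < x) (hxy : x < y) (hy : y < 1) :
    |pKer ν Λ t x y| ≤ 4 / (π * growthC ν) * ((1 - y) * (y ^ (2 * ν + 1))⁻¹) / (y - x) := by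
  have h1 : -1 < ν := by linarith
  have hc := growthC_pos h1
  have hpi := Real.pi_pos
  have hd : 0 < y - x := sub_pos.2 hxy
  have hy0 : 0 < y := hx.trans hxy
  set B := (1 - y) * (y ^ (2 * ν + 1))⁻¹ with hB
  have hB0 : 0 ≤ B := mul_nonneg (by linarith) (by positivity)
  have hs := summable_abs_eigE_mul_div hν hΛ ⟨hx, hxy.trans hy⟩ ⟨hy0, hy⟩
  set a : ℕ → ℝ := fun n => eigE ν Λ n x * eigE ν Λ n y with ha
  have hL := hΛ.2.1
  have hsum : ∀ R : ℝ, 0 ≤ R →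
      |∑' n, a n * ∫ u in (0 : ℝ)..R, cos (t * u) * (u ^ 2 + Λ n ^ 2)⁻¹| ≤
        2 * B * (growthC ν * (y - x))⁻¹ := fun R hR => by
    have h := intervalIntegral.hasSum_integral_of_dominated_convergence (μ := volume)
      (a := 0) (b := R) (F := fun n u => a n * (cos (t * u) * (u ^ 2 + Λ n ^ 2)⁻¹))
      (f := fun u => cos (t * u) * greenG ν (u ^ 2) x y)
      (fun n _ => |a n| / Λ n ^ 2)
      (fun n => by
        have : ∀ u : ℝ, u ^ 2 + Λ n ^ 2 ≠ 0 := fun u => by have := hL n; positivity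
        exact Continuous.aestronglyMeasurable (by fun_prop (disch := assumption)))
      (fun n => Eventually.of_forall fun u _ => by
        have := hL n
        rw [norm_mul, Real.norm_eq_abs, div_eq_mul_inv]
        refine mul_le_mul_of_nonneg_left ?_ (abs_nonneg (a n))
        rw [norm_mul, Real.norm_of_nonneg (by positivity : 0 ≤ (u ^ 2 + Λ n ^ 2)⁻¹)]
        refine (mul_le_of_le_one_left (by positivity) (abs_cos_le_one _)).trans ?_
        gcongr
        exact le_add_of_nonneg_left (sq_nonneg u))
      (Eventually.of_forall fun u _ => hs)
      intervalIntegrable_const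
      (Eventually.of_forall fun u _ => by
        have e : (fun n => a n * (cos (t * u) * (u ^ 2 + Λ n ^ 2)⁻¹)) =
            fun n => cos (t * u) * (a n / (u ^ 2 + Λ n ^ 2)) := funext fun n => by ring
        rw [e]
        exact (hasSum_greenG hν hΛ u hx hxy hy).mul_left _)
    simp_rw [intervalIntegral.integral_const_mul] at h
    rw [h.tsum_eq, ← Real.norm_eq_abs]
    refine (intervalIntegral.norm_integral_le_of_norm_le
      (g := fun u => 2 * B * exp (-(growthC ν * (y - x) * u))) hR
      (Eventually.of_forall fun u hu => ?_)
      (Continuous.intervalIntegrable (by fun_prop) _ _)).trans ?_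
    · rw [norm_mul, Real.norm_of_nonneg
        (greenG_nonneg h1 (sq_nonneg u) hx (hxy.trans hy).le hy.le)]
      refine (mul_le_of_le_one_left (greenG_nonneg h1 (sq_nonneg u) hx (hxy.trans hy).le hy.le)
        (abs_cos_le_one _)).trans ((greenG_le hν hu.1.le hx hxy.le hy.le).trans_eq ?_)
      rw [← hB, show growthC ν * u * (y - x) = growthC ν * (y - x) * u by ring]
      ring
    · rw [intervalIntegral.integral_const_mul]
      gcongr
      exact integral_exp_neg_mul_le (by positivity)
  have hlim := tendsto_tsum_of_dominated_convergence (𝓕 := (atTop : Filter ℝ))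
    (f := fun R n => a n * ∫ u in (0 : ℝ)..R, cos (t * u) * (u ^ 2 + Λ n ^ 2)⁻¹)
    (g := fun n => a n * (π / 2 * (exp (-t * Λ n) / Λ n)))
    (bound := fun n => t⁻¹ * (|a n| / Λ n ^ 2)) (hs.mul_left _)
    (fun n => by
      rw [← integral_cos_mul_inv (hL n) ht]
      exact (intervalIntegral_tendsto_integral_Ioi 0
        (integrable_cos_mul_inv (hL n) t).integrableOn tendsto_id).const_mul _)
    (by
      filter_upwards [eventually_ge_atTop 0] with R hR n
      rw [norm_mul, Real.norm_eq_abs, Real.norm_eq_abs]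
      refine (mul_le_mul_of_nonneg_left (abs_integral_cos_mul_inv_le (hL n) ht hR)
        (abs_nonneg _)).trans_eq ?_
      rw [mul_inv]
      ring)
  have hfin := le_of_tendsto hlim.abs (by
    filter_upwards [eventually_ge_atTop 0] with R hR using hsum R hR)
  have e : ∑' n, a n * (π / 2 * (exp (-t * Λ n) / Λ n)) = π / 2 * pKer ν Λ t x y := by
    rw [pKer_eq_tsum hν hΛ t hx hy0, ← tsum_mul_left]
    exact tsum_congr fun n => by ring
  rw [e, abs_mul, abs_of_pos (by positivity : 0 < π / 2)] at hfin
  calc |pKer ν Λ t x y| = 2 / π * (π / 2 * |pKer ν Λ t x y|) := by field_simp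
    _ ≤ 2 / π * (2 * B * (growthC ν * (y - x))⁻¹) := by gcongr
    _ = _ := by
      field_simp
      ring

lemma abs_pKer_le (hν : -(1 / 2 : ℝ) < ν) (hΛ : IsPositiveZerosOfBesselJ ν Λ) {t : ℝ}
    (ht : 0 < t) {x y : ℝ} (hx : x ∈ Ioo (0 : ℝ) 1) (hy : y ∈ Ioo (0 : ℝ) 1) (hne : x ≠ y) :
    |pKer ν Λ t x y| ≤ 4 / (π * growthC ν) *
      ((1 - max x y) * (max x y ^ (2 * ν + 1))⁻¹) / |x - y| := by
  rcases hne.lt_or_gt with h | h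
  · rw [max_eq_right h.le, abs_sub_comm, abs_of_pos (sub_pos.2 h)]
    exact abs_pKer_le_of_lt hν hΛ ht hx.1 h hy.2
  · rw [max_eq_left h.le, abs_of_pos (sub_pos.2 h), pKer_comm]
    exact abs_pKer_le_of_lt hν hΛ ht hy.1 h hx.2

end KernelBound

section Partition
variable {η : ℕ → ℝ → ℝ}

lemma mem_Istar_bounds {j : ℕ} {z : ℝ} (h : z ∈ Istar j) :
    99 / 200 * (1 / 2 : ℝ) ^ j ≤ 1 - z ∧ 1 - z < 201 / 200 * (1 / 2 : ℝ) ^ j := by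
  obtain ⟨⟨h1, h2⟩, -⟩ := h
  rw [pI, qI, pow_succ] at h1 h2
  constructor <;> linarith

lemma tsum_ofReal_partition (h0 : ∀ j x, 0 ≤ η j x ∧ η j x ≤ 1) {x : ℝ}
    (hx : ∑' j : ℕ, η j x = 1) : ∑' j, ENNReal.ofReal (η j x) = 1 := by
  have hs : Summable fun j => η j x := by
    by_contra h
    rw [tsum_eq_zero_of_not_summable h] at hx
    exact zero_ne_one hx
  rw [← ENNReal.ofReal_tsum_of_nonneg (fun j => (h0 j x).1) hs, hx, ENNReal.ofReal_one]

lemma tsum_partition_sub_le_two (h0 : ∀ j x, 0 ≤ η j x ∧ η j x ≤ 1) {x y : ℝ}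
    (hx : ∑' j : ℕ, η j x = 1) (hy : ∑' j : ℕ, η j y = 1) :
    ∑' j, ENNReal.ofReal |η j x - η j y| ≤ ENNReal.ofReal 2 := by
  have e : ENNReal.ofReal 2 = ∑' j, (ENNReal.ofReal (η j x) + ENNReal.ofReal (η j y)) := by
    rw [ENNReal.tsum_add, tsum_ofReal_partition h0 hx, tsum_ofReal_partition h0 hy,
      ENNReal.ofReal_ofNat, one_add_one_eq_two]
  rw [e]
  refine ENNReal.tsum_le_tsum fun j => ?_
  rw [← ENNReal.ofReal_add (h0 j x).1 (h0 j y).1]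
  refine ENNReal.ofReal_le_ofReal (abs_le.2 ?_)
  have := (h0 j x).1
  have := (h0 j y).1
  constructor <;> linarith

lemma partition_eq_ite (hsupp : ∀ j, Function.support (η j) ⊆ Istar j) {x : ℝ}
    (hx : ∑' j : ℕ, η j x = 1) (hx2 : x < 49 / 100) (j : ℕ) :
    η j x = if j = 0 then 1 else 0 := by
  have hz : ∀ j, j ≠ 0 → η j x = 0 := fun j hj => by
    by_contra h
    have := (mem_Istar_bounds (hsupp j h)).2
    have h2 : (1 / 2 : ℝ) ^ j ≤ (1 / 2) ^ 1 :=
      pow_le_pow_of_le_one (by norm_num) (by norm_num) (Nat.one_le_iff_ne_zero.2 hj)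
    linarith
  split_ifs with h
  · rw [h, ← hx, tsum_eq_single 0 hz]
  · exact hz j h

lemma tsum_partition_sub_le (hsupp : ∀ j, Function.support (η j) ⊆ Istar j) {A₀ : ℝ}
    (hC : ∀ j, ContDiffOn ℝ 1 (η j) (Ioo 0 1))
    (hd : ∀ j, ∀ x ∈ Ioo (0 : ℝ) 1, |deriv (η j) x| ≤ A₀ * 2 ^ j) (hA₀ : 0 < A₀) {x y : ℝ}
    (hx : x ∈ Ioo (0 : ℝ) 1) (hy : y ∈ Ioo (0 : ℝ) 1) (hxy : |x - y| ≤ (1 - y) / 2) :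
    ∑' j, ENNReal.ofReal |η j x - η j y| ≤ ENNReal.ofReal (6 * A₀ * |x - y| / (1 - y)) := by
  have hy1 : 0 < 1 - y := sub_pos.2 hy.2
  have hmv : ∀ j, |η j x - η j y| ≤ A₀ * 2 ^ j * |x - y| := fun j =>
    (convex_Ioo (0 : ℝ) 1).norm_image_sub_le_of_norm_deriv_le
      (fun z hz => ((hC j).differentiableOn one_ne_zero).differentiableAt (isOpen_Ioo.mem_nhds hz))
      (hd j) hy hx
  have hT : 1 ≤ 3 / (1 - y) := by
    rw [le_div_iff₀ hy1]
    linarith [hy.1]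
  obtain ⟨n, hn1, hn2⟩ := exists_nat_pow_near hT (one_lt_two (α := ℝ))
  have hpow : ∀ {j : ℕ} {z : ℝ}, (1 - y) / 2 ≤ 1 - z → z ∈ Istar j → j < n + 1 := by
    intro j z hz hj
    have h1 := (mem_Istar_bounds hj).2
    have h2 : (2 : ℝ) ^ j < 2 ^ (n + 1) := by
      refine lt_of_le_of_lt ?_ hn2
      rw [le_div_iff₀ hy1]
      have h3 : (2 : ℝ) ^ j * (1 / 2) ^ j = 1 := by rw [← mul_pow]; norm_num
      have h4 : (0 : ℝ) < 2 ^ j := by positivity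
      nlinarith
    exact (pow_lt_pow_iff_right₀ one_lt_two).1 h2
  have hz : ∀ j ∉ Finset.range (n + 1), ENNReal.ofReal |η j x - η j y| = 0 := fun j hj => by
    have hx0 : η j x = 0 := by
      by_contra h
      refine hj (Finset.mem_range.2 (hpow ?_ (hsupp j h)))
      linarith [(abs_le.1 hxy).2]
    have hy0 : η j y = 0 := by
      by_contra h
      refine hj (Finset.mem_range.2 (hpow ?_ (hsupp j h)))
      linarith
    rw [hx0, hy0, sub_zero, abs_zero, ENNReal.ofReal_zero]
  rw [tsum_eq_sum hz, ← ENNReal.ofReal_sum_of_nonneg fun j _ => abs_nonneg _]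
  refine ENNReal.ofReal_le_ofReal ((Finset.sum_le_sum fun j _ => hmv j).trans ?_)
  rw [← Finset.sum_mul, ← Finset.mul_sum, geom_sum_eq (by norm_num)]
  calc A₀ * (((2 : ℝ) ^ (n + 1) - 1) / (2 - 1)) * |x - y|
      ≤ A₀ * (2 * (3 / (1 - y))) * |x - y| := by
        gcongr
        rw [pow_succ]
        linarith
    _ = _ := by ring

end Partition

section Estimate
variable {ν : ℝ}

lemma tsum_partition_mul_bound_le (hν : -(1 / 2 : ℝ) < ν)
    {A₀ : ℝ} (hA₀ : 0 < A₀) {η : ℕ → ℝ → ℝ} (hC : ∀ j, ContDiffOn ℝ 1 (η j) (Ioo 0 1))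
    (hsupp : ∀ j, Function.support (η j) ⊆ Istar j) (h0 : ∀ j x, 0 ≤ η j x ∧ η j x ≤ 1)
    (hd : ∀ j, ∀ x ∈ Ioo (0 : ℝ) 1, |deriv (η j) x| ≤ A₀ * 2 ^ j)
    (hs : ∀ x ∈ Ioo (0 : ℝ) 1, ∑' j : ℕ, η j x = 1) {x y : ℝ} (hx : x ∈ Ioo (0 : ℝ) 1)
    (hy : y ∈ Ioo (0 : ℝ) 1) :
    (∑' j, ENNReal.ofReal |η j x - η j y|) * ENNReal.ofReal (4 / (π * growthC ν) *
      ((1 - max x y) * (max x y ^ (2 * ν + 1))⁻¹) / |x - y|) ≤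
      ENNReal.ofReal (4 / (π * growthC ν) * ((49 / 100 : ℝ) ^ (2 * ν + 1))⁻¹ * (4 + 6 * A₀)) := by
  have hc := growthC_pos (by linarith : -1 < ν)
  have hpi := Real.pi_pos
  have hy1 : 0 < 1 - y := sub_pos.2 hy.2
  rcases eq_or_ne x y with rfl | hne
  · simp
  have hdist : 0 < |x - y| := abs_pos.2 (sub_ne_zero.2 hne)
  rcases lt_or_ge (max x y) (49 / 100) with hM | hM
  · have : ∀ j, ENNReal.ofReal |η j x - η j y| = 0 := fun j => by
      rw [partition_eq_ite hsupp (hs x hx) ((le_max_left _ _).trans_lt hM),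
        partition_eq_ite hsupp (hs y hy) ((le_max_right _ _).trans_lt hM), sub_self, abs_zero,
        ENNReal.ofReal_zero]
    simp_rw [this, tsum_zero, zero_mul]
    exact zero_le
  set c := 4 / (π * growthC ν) with hcdef
  have hc0 : 0 < c := by positivity
  set b := ((49 / 100 : ℝ) ^ (2 * ν + 1))⁻¹ with hb
  have hb0 : 0 < b := by positivity
  have hK : c * ((1 - max x y) * (max x y ^ (2 * ν + 1))⁻¹) / |x - y| ≤
      c * ((1 - y) * b) / |x - y| := by
    have h1 : (max x y ^ (2 * ν + 1))⁻¹ ≤ b := by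
      have : 0 ≤ 2 * ν + 1 := by linarith
      rw [hb]
      gcongr
    have h2 : 0 ≤ (max x y ^ (2 * ν + 1))⁻¹ := by
      have := hy.1.trans_le (le_max_right x y)
      positivity
    have h3 := le_max_right x y
    gcongr
  refine (mul_le_mul_right (ENNReal.ofReal_le_ofReal hK) _).trans ?_
  rcases le_or_gt |x - y| ((1 - y) / 2) with hn | hf
  · refine (mul_le_mul_left (tsum_partition_sub_le hsupp hC hd hA₀ hx hy hn) _).trans ?_
    rw [← ENNReal.ofReal_mul (by positivity)]
    refine ENNReal.ofReal_le_ofReal ?_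
    calc 6 * A₀ * |x - y| / (1 - y) * (c * ((1 - y) * b) / |x - y|) = c * b * (6 * A₀) := by
          field_simp
      _ ≤ _ := by gcongr; linarith
  · refine (mul_le_mul_left (tsum_partition_sub_le_two h0 (hs x hx) (hs y hy)) _).trans ?_
    rw [← ENNReal.ofReal_mul (by positivity)]
    refine ENNReal.ofReal_le_ofReal ?_
    calc 2 * (c * ((1 - y) * b) / |x - y|) ≤ 2 * (c * ((1 - y) * b) / ((1 - y) / 2)) := by gcongr
      _ = c * b * 4 := by
        field_simp
        ring
      _ ≤ _ := by gcongr; linarith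

end Estimate

/-- Commutator estimate for a partition of unity adapted to the intervals `I_j*` (Lemma 4.8). -/
theorem partition_commutator_estimate_mu (ν : ℝ) (hν : -(1/2 : ℝ) < ν)
    (Λ : ℕ → ℝ) (hΛ : IsPositiveZerosOfBesselJ ν Λ) (A₀ : ℝ) (hA₀ : 0 < A₀) :
    ∃ C : ℝ, 0 < C ∧
      ∀ η : ℕ → ℝ → ℝ,
        (∀ j, ContDiffOn ℝ 1 (η j) (Ioo 0 1)) →
        (∀ j, Function.support (η j) ⊆ Istar j) →
        (∀ j x, 0 ≤ η j x ∧ η j x ≤ 1) →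
        (∀ j, ∀ x ∈ Ioo (0:ℝ) 1, |deriv (η j) x| ≤ A₀ * 2 ^ j) →
        (∀ x ∈ Ioo (0:ℝ) 1, ∑' j : ℕ, η j x = 1) →
        ∀ y ∈ Ioo (0:ℝ) 1,
          ∫⁻ x, (∑' j : ℕ,
              ⨆ t : {t : ℝ // 0 < t ∧ t < (muMeas ν (Istar2 j)).toReal},
                (‖(η j x - η j y) * pKer ν Λ t.1 x y‖₊ : ℝ≥0∞)) ∂(muMeas ν)
            ≤ ENNReal.ofReal C := by
  have hc := growthC_pos (by linarith : -1 < ν)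
  have hpi := Real.pi_pos
  refine ⟨4 / (π * growthC ν) * ((49 / 100 : ℝ) ^ (2 * ν + 1))⁻¹ * (4 + 6 * A₀), by positivity,
    fun η hC hsupp h0 hd hs y hy => ?_⟩
  set C := 4 / (π * growthC ν) * ((49 / 100 : ℝ) ^ (2 * ν + 1))⁻¹ * (4 + 6 * A₀)
  calc _ ≤ ∫⁻ _, ENNReal.ofReal C ∂(muMeas ν) := lintegral_mono_ae ?_
    _ = ENNReal.ofReal C * muMeas ν univ := lintegral_const _
    _ ≤ ENNReal.ofReal C * 1 := by
      gcongr
      exact muMeas_univ_le hν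
    _ = ENNReal.ofReal C := mul_one _
  filter_upwards [ae_mem_Ioo_muMeas ν] with x hx
  refine le_trans ?_ (tsum_partition_mul_bound_le hν hA₀ hC hsupp h0 hd hs hx hy)
  rw [← ENNReal.tsum_mul_right]
  refine ENNReal.tsum_le_tsum fun j => iSup_le fun t => ?_
  rcases eq_or_ne x y with rfl | hne
  · simp
  rw [← enorm_eq_nnnorm, enorm_mul, Real.enorm_eq_ofReal_abs, Real.enorm_eq_ofReal_abs]
  gcongr
  exact abs_pKer_le hν hΛ t.2.1 hx hy hne
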